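/- arXiv:2509.01707 — 5 statements merged into one kernel-verified Lean document; each statement's English description precedes it below -/
import Mathlib

section
/- Let n ≥ 1, N > 0 and δ > 0. There exists a constant C = C(n, N, δ) > 0 such that for every Borel measure μ on ℝ^{n+1} with λ[μ] < ∞ and every R > 0 one has ∫_{ℝ^{n+1} \ B_R(0)} (1 + |X|^N) e^{−|X|²/4} dμ(X) ≤ C · λ[μ] · e^{−R²/(4+δ)}. (In particular this applies with μ the n-dimensional Hausdorff measure restricted to a hypersurface Σ ⊂ ℝ^{n+1} of finite entropy, which is the form stated in the paper as Proposition 2.1.) -/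
open MeasureTheory Real

/-- The Colding–Minicozzi entropy of a Borel measure `μ` on `ℝ^{n+1}`:
`λ[μ] := sup_{X₀, t₀>0} (4π t₀)^{-n/2} ∫ exp(-|X-X₀|²/(4t₀)) dμ(X)`. -/
noncomputable def entropy (n : ℕ) (μ : Measure (EuclideanSpace ℝ (Fin (n + 1)))) : ENNReal :=
  ⨆ (X₀ : EuclideanSpace ℝ (Fin (n + 1))) (t₀ : ℝ) (_ : 0 < t₀),
    ∫⁻ X, ENNReal.ofReal ((4 * π * t₀) ^ (-(n : ℝ) / 2) *
      Real.exp (-‖X - X₀‖ ^ 2 / (4 * t₀))) ∂μ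

/-- A power of `r` is dominated by a Gaussian growth factor. -/
theorem rpow_le_mul_exp_mul_sq {N a r : ℝ} (hN : 0 < N) (ha : 0 < a) (hr : 0 ≤ r) :
    r ^ N ≤ (N / (2 * a)) ^ (N / 2) * Real.exp (a * r ^ 2) := by
  have hs : 0 ≤ 2 * a / N * r ^ 2 := by positivity
  have hle : 2 * a / N * r ^ 2 ≤ Real.exp (2 * a / N * r ^ 2) := by
    linarith [Real.add_one_le_exp (2 * a / N * r ^ 2)]
  have hpow : (2 * a / N * r ^ 2) ^ (N / 2) ≤ Real.exp (a * r ^ 2) := by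
    calc (2 * a / N * r ^ 2) ^ (N / 2) ≤ Real.exp (2 * a / N * r ^ 2) ^ (N / 2) :=
          Real.rpow_le_rpow hs hle (by positivity)
      _ = Real.exp (a * r ^ 2) := by
          rw [← Real.exp_mul]
          congr 1
          field_simp
  have hsq : r ^ N = (r ^ 2) ^ (N / 2) := by
    rw [← Real.rpow_natCast, ← Real.rpow_mul hr]
    congr 1
    push_cast
    ring
  calc r ^ N = (N / (2 * a) * (2 * a / N * r ^ 2)) ^ (N / 2) := by
        rw [hsq]
        congr 1
        field_simp
    _ = (N / (2 * a)) ^ (N / 2) * (2 * a / N * r ^ 2) ^ (N / 2) :=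
        Real.mul_rpow (by positivity) hs
    _ ≤ _ := by gcongr

/-- Outside radius `R`, the weighted Gaussian splits into a tail factor and a wider Gaussian. -/
theorem one_add_rpow_mul_exp_le {N b a R r : ℝ} (hN : 0 < N) (hb : 0 ≤ b) (ha : 0 < a)
    (hab : b + 2 * a = 1 / 4) (hR : 0 ≤ R) (hr : R ≤ r) :
    (1 + r ^ N) * Real.exp (-r ^ 2 / 4) ≤
      (1 + (N / (2 * a)) ^ (N / 2)) * Real.exp (-a * r ^ 2) * Real.exp (-b * R ^ 2) := by
  have hr0 : 0 ≤ r := hR.trans hr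
  have hK : 1 + r ^ N ≤ (1 + (N / (2 * a)) ^ (N / 2)) * Real.exp (a * r ^ 2) := by
    have h1 : 1 ≤ Real.exp (a * r ^ 2) := Real.one_le_exp (by positivity)
    linarith [rpow_le_mul_exp_mul_sq hN ha hr0]
  have hsplit : Real.exp (-r ^ 2 / 4) =
      Real.exp (-(a * r ^ 2)) * Real.exp (-a * r ^ 2) * Real.exp (-b * r ^ 2) := by
    rw [← Real.exp_add, ← Real.exp_add]
    congr 1
    linear_combination (r ^ 2) * hab
  have hcancel : Real.exp (a * r ^ 2) * Real.exp (-(a * r ^ 2)) = 1 := by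
    rw [← Real.exp_add, add_neg_cancel, Real.exp_zero]
  have htail : Real.exp (-b * r ^ 2) ≤ Real.exp (-b * R ^ 2) := by
    apply Real.exp_le_exp.2
    have : R ^ 2 ≤ r ^ 2 := by gcongr
    nlinarith
  calc (1 + r ^ N) * Real.exp (-r ^ 2 / 4)
      ≤ (1 + (N / (2 * a)) ^ (N / 2)) * Real.exp (a * r ^ 2) * Real.exp (-r ^ 2 / 4) := by
        gcongr
    _ = (1 + (N / (2 * a)) ^ (N / 2)) * Real.exp (-a * r ^ 2) * Real.exp (-b * r ^ 2) := by
        rw [hsplit]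
        linear_combination (1 + (N / (2 * a)) ^ (N / 2)) * Real.exp (-a * r ^ 2) *
          Real.exp (-b * r ^ 2) * hcancel
    _ ≤ _ := by gcongr

/-- A centred Gaussian integral is controlled by the entropy. -/
theorem lintegral_exp_neg_mul_sq_le_entropy (n : ℕ)
    (μ : Measure (EuclideanSpace ℝ (Fin (n + 1)))) {a : ℝ} (ha : 0 < a) :
    ∫⁻ X, ENNReal.ofReal (Real.exp (-a * ‖X‖ ^ 2)) ∂μ ≤
      ENNReal.ofReal ((π / a) ^ ((n : ℝ) / 2)) * entropy n μ := by
  have ht : 0 < 1 / (4 * a) := by positivity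
  have hpa : 0 < π / a := by positivity
  calc ∫⁻ X, ENNReal.ofReal (Real.exp (-a * ‖X‖ ^ 2)) ∂μ
      = ENNReal.ofReal ((π / a) ^ ((n : ℝ) / 2)) *
        ∫⁻ X, ENNReal.ofReal ((4 * π * (1 / (4 * a))) ^ (-(n : ℝ) / 2) *
          Real.exp (-‖X - 0‖ ^ 2 / (4 * (1 / (4 * a))))) ∂μ := by
        rw [← lintegral_const_mul' _ _ ENNReal.ofReal_ne_top]
        refine lintegral_congr fun X => ?_
        rw [← ENNReal.ofReal_mul (by positivity), ← mul_assoc]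
        have h1 : 4 * π * (1 / (4 * a)) = π / a := by field_simp
        have h2 : -‖X - 0‖ ^ 2 / (4 * (1 / (4 * a))) = -a * ‖X‖ ^ 2 := by
          rw [sub_zero]
          field_simp
        rw [h1, h2, ← Real.rpow_add hpa, neg_div, add_neg_cancel, Real.rpow_zero, one_mul]
    _ ≤ _ := by
        gcongr
        exact le_iSup_of_le 0 (le_iSup_of_le (1 / (4 * a)) (le_iSup_of_le ht le_rfl))

/-- Proposition 2.1 of the paper, measure form.
For `n ≥ 1`, `N > 0`, `δ > 0`, there is `C = C(n, N, δ) > 0` such that for every Borel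
measure `μ` on `ℝ^{n+1}` with finite entropy and every `R > 0`,
`∫_{ℝ^{n+1} ∖ B_R(0)} (1 + |X|^N) e^{-|X|²/4} dμ ≤ C · λ[μ] · e^{-R²/(4+δ)}`. -/
theorem stmt0 (n : ℕ) (hn : 1 ≤ n) (N δ : ℝ) (hN : 0 < N) (hδ : 0 < δ) :
    ∃ C : ℝ, 0 < C ∧
      ∀ μ : Measure (EuclideanSpace ℝ (Fin (n + 1))), entropy n μ ≠ ⊤ →
        ∀ R : ℝ, 0 < R →
          (∫⁻ X in (Metric.ball (0 : EuclideanSpace ℝ (Fin (n + 1))) R)ᶜ,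
              ENNReal.ofReal ((1 + ‖X‖ ^ N) * Real.exp (-‖X‖ ^ 2 / 4)) ∂μ)
            ≤ ENNReal.ofReal C * entropy n μ *
                ENNReal.ofReal (Real.exp (-R ^ 2 / (4 + δ))) := by
  have h4 : 0 < 4 + δ := by positivity
  set b : ℝ := 1 / (4 + δ) with hb
  set a : ℝ := δ / (8 * (4 + δ)) with ha
  have hb0 : 0 < b := by positivity
  have ha0 : 0 < a := by positivity
  have hab : b + 2 * a = 1 / 4 := by
    rw [ha, hb]
    field_simp
    ring
  set K : ℝ := 1 + (N / (2 * a)) ^ (N / 2) with hK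
  have hK0 : 0 < K := by positivity
  refine ⟨K * (π / a) ^ ((n : ℝ) / 2), by positivity, fun μ _ R hR => ?_⟩
  have hexp : Real.exp (-R ^ 2 / (4 + δ)) = Real.exp (-b * R ^ 2) := by
    congr 1
    rw [hb]
    ring
  rw [hexp]
  calc ∫⁻ X in (Metric.ball (0 : EuclideanSpace ℝ (Fin (n + 1))) R)ᶜ,
        ENNReal.ofReal ((1 + ‖X‖ ^ N) * Real.exp (-‖X‖ ^ 2 / 4)) ∂μ
      ≤ ∫⁻ X in (Metric.ball (0 : EuclideanSpace ℝ (Fin (n + 1))) R)ᶜ,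
        ENNReal.ofReal (K * Real.exp (-b * R ^ 2)) *
          ENNReal.ofReal (Real.exp (-a * ‖X‖ ^ 2)) ∂μ := by
        refine setLIntegral_mono' Metric.isOpen_ball.measurableSet.compl fun X hX => ?_
        have hRX : R ≤ ‖X‖ := by simpa using hX
        rw [← ENNReal.ofReal_mul (by positivity), mul_right_comm]
        exact ENNReal.ofReal_le_ofReal
          (one_add_rpow_mul_exp_le hN hb0.le ha0 hab hR.le hRX)
    _ ≤ ∫⁻ X, ENNReal.ofReal (K * Real.exp (-b * R ^ 2)) *
          ENNReal.ofReal (Real.exp (-a * ‖X‖ ^ 2)) ∂μ := setLIntegral_le_lintegral _ _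
    _ = ENNReal.ofReal (K * Real.exp (-b * R ^ 2)) *
          ∫⁻ X, ENNReal.ofReal (Real.exp (-a * ‖X‖ ^ 2)) ∂μ :=
        lintegral_const_mul' _ _ ENNReal.ofReal_ne_top
    _ ≤ ENNReal.ofReal (K * Real.exp (-b * R ^ 2)) *
          (ENNReal.ofReal ((π / a) ^ ((n : ℝ) / 2)) * entropy n μ) := by
        gcongr
        exact lintegral_exp_neg_mul_sq_le_entropy n μ ha0
    _ = _ := by
        rw [ENNReal.ofReal_mul hK0.le, ENNReal.ofReal_mul hK0.le]
        ring
end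

section
/- Let k ≥ 1 and l ≥ 2 be integers. There exists c = c(k, l) > 0 such that for every Hermitian polynomial h on ℝ^k of degree l, every a ∈ ℝ, and every 𝐲 ∈ ℝ^k with |𝐲| ≥ 1, one has ( ∫_{ℝ^k} |a + h(y + 𝐲) − h(y)|² e^{−|y|²/4} dy )^{1/2} ≥ c · |𝐲|^{1−l} · |a|. -/
open MeasureTheory Real

/-- `h : ℝ^k → ℝ` (as a multivariate polynomial) is a Hermitian polynomial of degree `l`:
it has degree `l` and satisfies `Δh - (1/2)⟨y, ∇h⟩ + (l/2) h = 0`, i.e. it is an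
eigenfunction of the Ornstein–Uhlenbeck operator `Δ - (1/2) y·∇` with eigenvalue `-l/2`. -/
def IsHermitianPoly (k l : ℕ) (h : MvPolynomial (Fin k) ℝ) : Prop :=
  h.totalDegree = l ∧
    (∑ i : Fin k, MvPolynomial.pderiv i (MvPolynomial.pderiv i h))
        - MvPolynomial.C (1 / 2 : ℝ) * ∑ i : Fin k, MvPolynomial.X i * MvPolynomial.pderiv i h
        + MvPolynomial.C ((l : ℝ) / 2) * h = 0

section GaussianIntegration

open MvPolynomial

variable {k : ℕ}

theorem integrable_eval_mul_exp_neg_norm_sq (p : MvPolynomial (Fin k) ℝ) :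
    Integrable (fun y : EuclideanSpace ℝ (Fin k) =>
      eval (fun i => y i) p * Real.exp (-‖y‖ ^ 2 / 4)) := by
  induction p using MvPolynomial.induction_on' with
  | add p q hp hq =>
    refine (hp.add hq).congr (Filter.Eventually.of_forall fun y => ?_)
    simp [add_mul]
  | monomial m r =>
    have hone (i : Fin k) :
        Integrable (fun t : ℝ => t ^ m i * Real.exp (-(1 / 4) * t ^ 2)) := by
      have := integrable_rpow_mul_exp_neg_mul_sq (b := 1 / 4) (by norm_num)
        (s := (m i : ℝ)) (by linarith [(m i).cast_nonneg (α := ℝ)])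
      simpa only [Real.rpow_natCast] using this
    have hpi := (Integrable.fintype_prod (μ := fun _ : Fin k => volume) hone).const_mul r
    have hE := (PiLp.volume_preserving_ofLp (Fin k)).integrable_comp_of_integrable hpi
    refine hE.congr (Filter.Eventually.of_forall fun y => ?_)
    simp only [Function.comp, Finset.prod_mul_distrib, ← Real.exp_sum, ← Finset.mul_sum,
      EuclideanSpace.norm_sq_eq, Real.norm_eq_abs, sq_abs, eval_monomial]
    rw [Finsupp.prod_fintype _ _ (by simp), mul_assoc]
    congr 3
    ring

/-- Integration of a polynomial against the Gaussian weight `e^{-|y|²/4}`. -/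
noncomputable def gaussianIntegral (k : ℕ) : MvPolynomial (Fin k) ℝ →ₗ[ℝ] ℝ where
  toFun p := ∫ y : EuclideanSpace ℝ (Fin k), eval (fun i => y i) p * Real.exp (-‖y‖ ^ 2 / 4)
  map_add' p q := by
    simp only [map_add, add_mul]
    exact integral_add (integrable_eval_mul_exp_neg_norm_sq p)
      (integrable_eval_mul_exp_neg_norm_sq q)
  map_smul' r p := by
    simp only [smul_eval, mul_assoc, integral_const_mul, RingHom.id_apply, smul_eq_mul]

theorem gaussianIntegral_apply (p : MvPolynomial (Fin k) ℝ) :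
    gaussianIntegral k p =
      ∫ y : EuclideanSpace ℝ (Fin k), eval (fun i => y i) p * Real.exp (-‖y‖ ^ 2 / 4) :=
  rfl

theorem gaussianIntegral_C_mul (r : ℝ) (p : MvPolynomial (Fin k) ℝ) :
    gaussianIntegral k (C r * p) = r * gaussianIntegral k p := by
  rw [C_mul', map_smul, smul_eq_mul]

theorem gaussianIntegral_sq_nonneg (p : MvPolynomial (Fin k) ℝ) :
    0 ≤ gaussianIntegral k (p ^ 2) := by
  rw [gaussianIntegral_apply]
  refine integral_nonneg fun y => ?_
  simp only [Pi.zero_apply, map_pow]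
  positivity

theorem gaussianIntegral_one_pos : 0 < gaussianIntegral k 1 := by
  have hint := integrable_eval_mul_exp_neg_norm_sq (1 : MvPolynomial (Fin k) ℝ)
  simp only [map_one, one_mul] at hint
  rw [gaussianIntegral_apply]
  simp only [map_one, one_mul]
  exact integral_exp_pos hint

theorem gaussianIntegral_mul_sq_le (p q : MvPolynomial (Fin k) ℝ) :
    gaussianIntegral k (p * q) ^ 2 ≤ gaussianIntegral k (p ^ 2) * gaussianIntegral k (q ^ 2) := by
  have h (t : ℝ) : 0 ≤ gaussianIntegral k (q ^ 2) * (t * t) +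
      2 * gaussianIntegral k (p * q) * t + gaussianIntegral k (p ^ 2) := by
    have h0 := gaussianIntegral_sq_nonneg (C t * q + p)
    have he : (C t * q + p) ^ 2 = C (t * t) * q ^ 2 + C (2 * t) * (p * q) + p ^ 2 := by
      simp only [map_mul, map_ofNat]
      ring
    rw [he, map_add, map_add, gaussianIntegral_C_mul, gaussianIntegral_C_mul] at h0
    linarith
  have := discrim_le_zero h
  rw [discrim] at this
  linarith

theorem hasLineDerivAt_eval (p : MvPolynomial (Fin k) ℝ) (i : Fin k)
    (x : EuclideanSpace ℝ (Fin k)) :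
    HasLineDerivAt ℝ (fun y : EuclideanSpace ℝ (Fin k) => eval (fun j => y j) p)
      (eval (fun j => x j) (pderiv i p)) x (EuclideanSpace.single i 1) := by
  unfold HasLineDerivAt
  induction p using MvPolynomial.induction_on with
  | C a => simpa using hasDerivAt_const (0 : ℝ) a
  | add p q hp hq =>
    simp only [map_add]
    exact hp.add hq
  | mul_X p j hp =>
    have hX : HasDerivAt (fun t : ℝ => (x + t • EuclideanSpace.single i (1 : ℝ)) j)
        ((Pi.single i 1 : Fin k → ℝ) j) 0 := by
      have := ((hasDerivAt_id (0 : ℝ)).mul_const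
        ((EuclideanSpace.single i (1 : ℝ)) j)).const_add (x j)
      simpa [Pi.single_apply] using this
    have := hp.mul hX
    have hs : eval (fun j => x j) ((Pi.single i 1 : Fin k → MvPolynomial (Fin k) ℝ) j) =
        (Pi.single i 1 : Fin k → ℝ) j := by
      by_cases h : j = i <;> simp [h]
    convert! this using 1
    · ext t
      simp
    · simp [hs]
      ring

theorem hasLineDerivAt_exp_neg_norm_sq (i : Fin k) (x : EuclideanSpace ℝ (Fin k)) :
    HasLineDerivAt ℝ (fun y : EuclideanSpace ℝ (Fin k) => Real.exp (-‖y‖ ^ 2 / 4))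
      (-(1 / 2) * x i * Real.exp (-‖x‖ ^ 2 / 4)) x (EuclideanSpace.single i 1) := by
  have h := ((hasStrictFDerivAt_norm_sq x).hasFDerivAt.hasLineDerivAt
    (EuclideanSpace.single i (1 : ℝ)))
  unfold HasLineDerivAt at h ⊢
  have := ((h.neg).div_const 4).exp
  convert! this using 1
  simp [EuclideanSpace.inner_single_right]
  ring

theorem gaussianIntegral_X_mul (p : MvPolynomial (Fin k) ℝ) (i : Fin k) :
    gaussianIntegral k (X i * p) = 2 * gaussianIntegral k (pderiv i p) := by
  have hint := (integrable_eval_mul_exp_neg_norm_sq (X i * p)).const_mul (-(1 / 2))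
  have h := integral_bilinear_hasLineDerivAt_right_eq_neg_left_of_integrable
    (μ := (volume : Measure (EuclideanSpace ℝ (Fin k)))) (v := EuclideanSpace.single i (1 : ℝ))
    (B := ContinuousLinearMap.mul ℝ ℝ)
    (f := fun y : EuclideanSpace ℝ (Fin k) => eval (fun j => y j) p)
    (f' := fun y => eval (fun j => y j) (pderiv i p))
    (g := fun y => Real.exp (-‖y‖ ^ 2 / 4))
    (g' := fun y => -(1 / 2) * y i * Real.exp (-‖y‖ ^ 2 / 4))
    (integrable_eval_mul_exp_neg_norm_sq _)
    (hint.congr (Filter.Eventually.of_forall fun y => by simp; ring))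
    (integrable_eval_mul_exp_neg_norm_sq _)
    (fun x _ => hasLineDerivAt_eval p i x) (fun x _ => hasLineDerivAt_exp_neg_norm_sq i x)
  simp only [ContinuousLinearMap.mul_apply', ← gaussianIntegral_apply] at h
  have h' : gaussianIntegral k (X i * p) * (-(1 / 2)) = - gaussianIntegral k (pderiv i p) := by
    rw [← h, gaussianIntegral_apply, ← integral_mul_const]
    congr 1
    ext y
    simp
    ring
  linarith

/-- The linear polynomial `⟨Y, y⟩`. -/
noncomputable def innerPoly (Y : Fin k → ℝ) : MvPolynomial (Fin k) ℝ := ∑ i, C (Y i) * X i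

/-- The directional derivative `Y · ∇` on polynomials. -/
noncomputable def dirDeriv (Y : Fin k → ℝ) (p : MvPolynomial (Fin k) ℝ) :
    MvPolynomial (Fin k) ℝ := ∑ i, C (Y i) * pderiv i p

theorem pderiv_innerPoly (Y : Fin k → ℝ) (i : Fin k) : pderiv i (innerPoly Y) = C (Y i) := by
  simp [innerPoly, Pi.single_apply]

theorem gaussianIntegral_innerPoly_mul (Y : Fin k → ℝ) (p : MvPolynomial (Fin k) ℝ) :
    gaussianIntegral k (innerPoly Y * p) = 2 * gaussianIntegral k (dirDeriv Y p) := by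
  simp only [innerPoly, dirDeriv, Finset.sum_mul, map_sum, mul_assoc, gaussianIntegral_C_mul,
    gaussianIntegral_X_mul, Finset.mul_sum]
  exact Finset.sum_congr rfl fun i _ => by ring

/-- The Ornstein–Uhlenbeck operator `Δ - (1/2) y·∇` on polynomials. -/
noncomputable def ornsteinUhlenbeck (p : MvPolynomial (Fin k) ℝ) : MvPolynomial (Fin k) ℝ :=
  (∑ i, pderiv i (pderiv i p)) - C (1 / 2 : ℝ) * ∑ i, X i * pderiv i p

theorem gaussianIntegral_ornsteinUhlenbeck (p : MvPolynomial (Fin k) ℝ) :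
    gaussianIntegral k (ornsteinUhlenbeck p) = 0 := by
  simp only [ornsteinUhlenbeck, map_sub, gaussianIntegral_C_mul, map_sum, gaussianIntegral_X_mul,
    ← Finset.mul_sum]
  ring

theorem gaussianIntegral_innerPoly_mul_ornsteinUhlenbeck (Y : Fin k → ℝ)
    (p : MvPolynomial (Fin k) ℝ) :
    gaussianIntegral k (innerPoly Y * ornsteinUhlenbeck p) =
      -(1 / 2) * gaussianIntegral k (innerPoly Y * p) := by
  have hX (i : Fin k) : gaussianIntegral k (innerPoly Y * (X i * pderiv i p)) =
      2 * (gaussianIntegral k (C (Y i) * pderiv i p) +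
        gaussianIntegral k (innerPoly Y * pderiv i (pderiv i p))) := by
    rw [mul_left_comm, gaussianIntegral_X_mul, pderiv_mul, pderiv_innerPoly, map_add]
  rw [gaussianIntegral_innerPoly_mul Y p, ornsteinUhlenbeck, mul_sub, mul_left_comm, map_sub,
    gaussianIntegral_C_mul]
  simp only [dirDeriv, Finset.mul_sum, map_sum, hX, mul_add, Finset.sum_add_distrib]
  simp only [← Finset.mul_sum]
  ring

/-- Translation of a polynomial: `y ↦ p (y + Y)`. -/
noncomputable def translatePoly (Y : Fin k → ℝ) :
    MvPolynomial (Fin k) ℝ →ₐ[ℝ] MvPolynomial (Fin k) ℝ :=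
  aeval fun i => X i + C (Y i)

theorem eval_translatePoly (Y y : Fin k → ℝ) (p : MvPolynomial (Fin k) ℝ) :
    eval y (translatePoly Y p) = eval (fun i => y i + Y i) p := by
  induction p using MvPolynomial.induction_on with
  | C a => simp [translatePoly]
  | add p q hp hq => simp [hp, hq]
  | mul_X p i hp =>
    have hX : translatePoly Y (X i) = X i + C (Y i) := by simp [translatePoly]
    simp [hp, hX]

theorem pderiv_translatePoly (Y : Fin k → ℝ) (i : Fin k) (p : MvPolynomial (Fin k) ℝ) :
    pderiv i (translatePoly Y p) = translatePoly Y (pderiv i p) := by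
  induction p using MvPolynomial.induction_on with
  | C a => simp [translatePoly]
  | add p q hp hq => simp [hp, hq]
  | mul_X p j hp =>
    have hX : translatePoly Y (X j) = X j + C (Y j) := by simp [translatePoly]
    by_cases h : j = i
    · subst h
      simp [hp, hX]
    · simp [hp, hX, pderiv_X_of_ne h]

theorem translatePoly_ornsteinUhlenbeck (Y : Fin k → ℝ) (p : MvPolynomial (Fin k) ℝ) :
    translatePoly Y (ornsteinUhlenbeck p) =
      ornsteinUhlenbeck (translatePoly Y p) - C (1 / 2 : ℝ) * dirDeriv Y (translatePoly Y p) := by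
  have hX (j : Fin k) : translatePoly Y (X j) = X j + C (Y j) := by simp [translatePoly]
  have hC (r : ℝ) : translatePoly Y (C r) = C r := by simp [translatePoly]
  simp only [ornsteinUhlenbeck, dirDeriv, map_sub, map_mul, map_sum, hX, hC, pderiv_translatePoly,
    add_mul, Finset.sum_add_distrib]
  ring

/-- The affine polynomial `1 - ⟨Y, y⟩ / (2l)`. -/
noncomputable def affineTest (l : ℕ) (Y : Fin k → ℝ) : MvPolynomial (Fin k) ℝ :=
  1 - C (1 / (2 * l) : ℝ) * innerPoly Y

theorem gaussianIntegral_affineTest_mul (l : ℕ) (Y : Fin k → ℝ) (p : MvPolynomial (Fin k) ℝ) :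
    gaussianIntegral k (affineTest l Y * p) =
      gaussianIntegral k p - 1 / (2 * l) * gaussianIntegral k (innerPoly Y * p) := by
  rw [affineTest, sub_mul, one_mul, mul_assoc, map_sub, gaussianIntegral_C_mul]

theorem gaussianIntegral_innerPoly (Y : Fin k → ℝ) : gaussianIntegral k (innerPoly Y) = 0 := by
  simpa [dirDeriv] using gaussianIntegral_innerPoly_mul Y 1

theorem gaussianIntegral_affineTest (l : ℕ) (Y : Fin k → ℝ) :
    gaussianIntegral k (affineTest l Y) = gaussianIntegral k 1 := by
  simpa [gaussianIntegral_innerPoly] using gaussianIntegral_affineTest_mul l Y 1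

theorem gaussianIntegral_affineTest_sq (l : ℕ) (hl : l ≠ 0) (Y : Fin k → ℝ) :
    gaussianIntegral k (affineTest l Y ^ 2) =
      (1 + (∑ i, Y i ^ 2) / (2 * l ^ 2)) * gaussianIntegral k 1 := by
  have hl' : (l : ℝ) ≠ 0 := by exact_mod_cast hl
  have hsq : gaussianIntegral k (innerPoly Y * innerPoly Y) =
      2 * ((∑ i, Y i ^ 2) * gaussianIntegral k 1) := by
    rw [gaussianIntegral_innerPoly_mul, dirDeriv]
    simp only [pderiv_innerPoly, map_sum, ← sq, ← C_pow, Finset.sum_mul]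
    congr 2
    ext i
    rw [← mul_one (C _), gaussianIntegral_C_mul]
  have hw : gaussianIntegral k (innerPoly Y * affineTest l Y) =
      -(1 / (2 * l)) * (2 * ((∑ i, Y i ^ 2) * gaussianIntegral k 1)) := by
    rw [mul_comm, gaussianIntegral_affineTest_mul, gaussianIntegral_innerPoly, hsq]
    ring
  rw [sq, gaussianIntegral_affineTest_mul, gaussianIntegral_affineTest, hw]
  field_simp
  ring

end GaussianIntegration

namespace IsHermitianPoly

open MvPolynomial

variable {k l : ℕ} {h : MvPolynomial (Fin k) ℝ}

theorem ornsteinUhlenbeck_eq (hh : IsHermitianPoly k l h) :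
    ornsteinUhlenbeck h = C (-(l / 2 : ℝ)) * h := by
  have := hh.2
  rw [map_neg, neg_mul]
  exact eq_neg_of_add_eq_zero_left this

theorem gaussianIntegral_eq_zero (hh : IsHermitianPoly k l h) (hl : l ≠ 0) :
    gaussianIntegral k h = 0 := by
  have := gaussianIntegral_ornsteinUhlenbeck h
  rw [hh.ornsteinUhlenbeck_eq, gaussianIntegral_C_mul] at this
  simpa [hl] using this

theorem gaussianIntegral_innerPoly_mul_eq_zero (hh : IsHermitianPoly k l h) (hl : l ≠ 1)
    (Y : Fin k → ℝ) : gaussianIntegral k (innerPoly Y * h) = 0 := by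
  have := gaussianIntegral_innerPoly_mul_ornsteinUhlenbeck Y h
  rw [hh.ornsteinUhlenbeck_eq, mul_left_comm, gaussianIntegral_C_mul] at this
  have hl' : (l : ℝ) - 1 ≠ 0 := sub_ne_zero.2 (by exact_mod_cast hl)
  exact (mul_eq_zero.1 (by linear_combination -2 * this :
    ((l : ℝ) - 1) * gaussianIntegral k (innerPoly Y * h) = 0)).resolve_left hl'

theorem gaussianIntegral_affineTest_mul_translatePoly (hh : IsHermitianPoly k l h) (hl : l ≠ 0)
    (Y : Fin k → ℝ) : gaussianIntegral k (affineTest l Y * translatePoly Y h) = 0 := by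
  have hl' : (l : ℝ) ≠ 0 := by exact_mod_cast hl
  have := congrArg (gaussianIntegral k) (translatePoly_ornsteinUhlenbeck Y h)
  have hC (r : ℝ) : translatePoly Y (C r) = C r := by simp [translatePoly]
  rw [hh.ornsteinUhlenbeck_eq, map_mul, hC, map_sub, gaussianIntegral_ornsteinUhlenbeck,
    gaussianIntegral_C_mul, gaussianIntegral_C_mul] at this
  rw [gaussianIntegral_affineTest_mul, gaussianIntegral_innerPoly_mul]
  field_simp
  linear_combination -2 * this

theorem gaussianIntegral_affineTest_mul_add_translatePoly_sub (hh : IsHermitianPoly k l h)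
    (hl : 2 ≤ l) (a : ℝ) (Y : Fin k → ℝ) :
    gaussianIntegral k (affineTest l Y * (C a + translatePoly Y h - h)) =
      a * gaussianIntegral k 1 := by
  rw [mul_sub, mul_add, map_sub, map_add,
    hh.gaussianIntegral_affineTest_mul_translatePoly (by omega), gaussianIntegral_affineTest_mul _ _ h,
    hh.gaussianIntegral_eq_zero (by omega), hh.gaussianIntegral_innerPoly_mul_eq_zero (by omega),
    mul_comm, gaussianIntegral_C_mul, gaussianIntegral_affineTest]
  ring

theorem sq_mul_le_gaussianIntegral (hh : IsHermitianPoly k l h) (hl : 2 ≤ l) (a : ℝ)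
    (Y : EuclideanSpace ℝ (Fin k)) (hY : 1 ≤ ‖Y‖) :
    gaussianIntegral k 1 / 2 * (‖Y‖⁻¹ * |a|) ^ 2 ≤
      gaussianIntegral k ((C a + translatePoly Y h - h) ^ 2) := by
  set F := C a + translatePoly Y h - h
  have hG : 0 < gaussianIntegral k 1 := gaussianIntegral_one_pos
  have hcs := gaussianIntegral_mul_sq_le (affineTest l Y) F
  have hl' : (2 : ℝ) ≤ l := by exact_mod_cast hl
  have hnorm : ∑ i, Y i ^ 2 = ‖Y‖ ^ 2 := by
    simp [EuclideanSpace.norm_sq_eq, Real.norm_eq_abs, sq_abs]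
  rw [hh.gaussianIntegral_affineTest_mul_add_translatePoly_sub hl,
    gaussianIntegral_affineTest_sq l (by omega), hnorm] at hcs
  have hbound : 1 + ‖Y‖ ^ 2 / (2 * l ^ 2) ≤ 2 * ‖Y‖ ^ 2 := by
    have h1 : ‖Y‖ ^ 2 / (2 * l ^ 2) ≤ ‖Y‖ ^ 2 := div_le_self (by positivity) (by nlinarith)
    nlinarith
  have hle : a ^ 2 * gaussianIntegral k 1 ≤ 2 * ‖Y‖ ^ 2 * gaussianIntegral k (F ^ 2) := by
    have := mul_le_mul_of_nonneg_right hbound (gaussianIntegral_sq_nonneg F)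
    refine le_of_mul_le_mul_right ?_ hG
    nlinarith
  have hY0 : 0 < ‖Y‖ := by linarith
  rw [mul_pow, sq_abs, inv_pow]
  field_simp
  linarith

end IsHermitianPoly

/-- Lemma 2.2 of the paper.
For integers `k ≥ 1`, `l ≥ 2` there is `c = c(k,l) > 0` such that for every Hermitian
polynomial `h` on `ℝ^k` of degree `l`, every `a ∈ ℝ` and every `𝐲 ∈ ℝ^k` with `|𝐲| ≥ 1`,
`‖a + h(·+𝐲) - h‖_{L²(Gaussian)} ≥ c |𝐲|^{1-l} |a|`. -/
theorem stmt1 (k l : ℕ) (hk : 1 ≤ k) (hl : 2 ≤ l) :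
    ∃ c : ℝ, 0 < c ∧
      ∀ h : MvPolynomial (Fin k) ℝ, IsHermitianPoly k l h →
        ∀ a : ℝ, ∀ Y : EuclideanSpace ℝ (Fin k), 1 ≤ ‖Y‖ →
          c * ‖Y‖ ^ ((1 : ℝ) - l) * |a| ≤
            Real.sqrt (∫ y : EuclideanSpace ℝ (Fin k),
              (a + MvPolynomial.eval (fun i => (y + Y) i) h
                  - MvPolynomial.eval (fun i => y i) h) ^ 2 *
                Real.exp (-‖y‖ ^ 2 / 4)) := by
  refine ⟨√(gaussianIntegral k 1 / 2), Real.sqrt_pos.2 (half_pos gaussianIntegral_one_pos),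
    fun h hh a Y hY => ?_⟩
  have hint : (∫ y : EuclideanSpace ℝ (Fin k),
      (a + MvPolynomial.eval (fun i => (y + Y) i) h
        - MvPolynomial.eval (fun i => y i) h) ^ 2 * Real.exp (-‖y‖ ^ 2 / 4)) =
      gaussianIntegral k ((MvPolynomial.C a + translatePoly Y h - h) ^ 2) := by
    simp [gaussianIntegral_apply, eval_translatePoly]
  have hpow : ‖Y‖ ^ ((1 : ℝ) - l) ≤ ‖Y‖⁻¹ := by
    have hl' : (2 : ℝ) ≤ l := by exact_mod_cast hl
    rw [← Real.rpow_neg_one]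
    exact Real.rpow_le_rpow_of_exponent_le hY (by linarith)
  calc √(gaussianIntegral k 1 / 2) * ‖Y‖ ^ ((1 : ℝ) - l) * |a|
      ≤ √(gaussianIntegral k 1 / 2) * (‖Y‖⁻¹ * |a|) := by
        rw [mul_assoc]
        gcongr
    _ = √(gaussianIntegral k 1 / 2 * (‖Y‖⁻¹ * |a|) ^ 2) := by
        rw [Real.sqrt_mul (half_pos gaussianIntegral_one_pos).le,
          Real.sqrt_sq (by positivity)]
    _ ≤ _ := by
        rw [hint]
        exact Real.sqrt_le_sqrt (hh.sq_mul_le_gaussianIntegral hl a Y hY)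
end

section
/- Let n ≥ 1, β ∈ (0, n+2], and let E ⊆ ℝ^n × ℝ be a set with H^β_P(E) > 0, where H^β_P denotes the β-dimensional Hausdorff measure built from the parabolic distance d_P. Then for H^β_P-almost every point p∘ ∈ E there is a sequence r_j ↓ 0 such that the accumulation set A_{E,p∘} := { z in the closed parabolic ball of radius 1/2 about the origin : there exist indices j_ℓ → ∞ and points z_ℓ ∈ ( r_{j_ℓ}^{−1}.(E − p∘) ) ∩ P_{1/2} with z_ℓ → z } satisfies H^β_P(A_{E,p∘}) > 0. Here r^{−1}.(X,t) := (X/r, t/r²) is the parabolic dilation applied to each point of a set, E − p∘ is the translate of E by −p∘, and P_{1/2} := { q : d_P(q, (0,0)) < 1/2 }. -/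
open MeasureTheory Filter Topology

/-- Parabolic spacetime `ℝ^n × ℝ`. -/
abbrev PSp (n : ℕ) := EuclideanSpace ℝ (Fin n) × ℝ

/-- The parabolic distance `d_P((X₁,t₁),(X₂,t₂)) = max(|X₁-X₂|, |t₁-t₂|^{1/2})`. -/
noncomputable def pdist {n : ℕ} (p q : PSp n) : ℝ :=
  max (dist p.1 q.1) (Real.sqrt (dist p.2 q.2))

/-- Diameter of a set with respect to the parabolic distance. -/
noncomputable def pdiam {n : ℕ} (s : Set (PSp n)) : ENNReal :=
  ⨆ (p) (_ : p ∈ s) (q) (_ : q ∈ s), ENNReal.ofReal (pdist p q)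

/-- Parabolic Hausdorff premeasure `H^β_{P,δ}`. -/
noncomputable def pHpre {n : ℕ} (β δ : ℝ) (E : Set (PSp n)) : ENNReal :=
  ⨅ (c : ℕ → Set (PSp n)) (_ : E ⊆ ⋃ i, c i) (_ : ∀ i, pdiam (c i) < ENNReal.ofReal δ),
    ∑' i, pdiam (c i) ^ β

/-- Parabolic Hausdorff measure `H^β_P = lim_{δ→0} H^β_{P,δ} = sup_{δ>0} H^β_{P,δ}`. -/
noncomputable def pH {n : ℕ} (β : ℝ) (E : Set (PSp n)) : ENNReal :=
  ⨆ (δ : ℝ) (_ : 0 < δ), pHpre β δ E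

/-- Parabolic dilation `r⁻¹.(X,t) = (X/r, t/r²)`. -/
noncomputable def pdil {n : ℕ} (r : ℝ) (p : PSp n) : PSp n := (r⁻¹ • p.1, p.2 / r ^ 2)

/-- The accumulation set `𝒜_{E,p₀}` of `E` at `p₀` along the scales `r_j`:
points `z` of the closed parabolic ball of radius `1/2` obtained as limits of points
`z_ℓ ∈ r_{j_ℓ}^{-1}.(E - p₀) ∩ P_{1/2}` with `j_ℓ → ∞`. -/
noncomputable def accSet {n : ℕ} (E : Set (PSp n)) (p₀ : PSp n) (r : ℕ → ℝ) : Set (PSp n) :=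
  {z | pdist z 0 ≤ 1 / 2 ∧
    ∃ (jl : ℕ → ℕ) (zl : ℕ → PSp n),
      Tendsto jl atTop atTop ∧
      (∀ l, zl l ∈ (pdil (r (jl l)) '' ((fun q => q - p₀) '' E)) ∩ {q | pdist q 0 < 1 / 2}) ∧
      Tendsto (fun l => pdist (zl l) z) atTop (𝓝 0)}

section ParabolicMetric

variable {n : ℕ}

lemma sqrt_add_le_sqrt_add_sqrt {a b : ℝ} (ha : 0 ≤ a) (hb : 0 ≤ b) :
    Real.sqrt (a + b) ≤ Real.sqrt a + Real.sqrt b := by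
  refine Real.sqrt_le_iff.2 ⟨by positivity, ?_⟩
  nlinarith [Real.sq_sqrt ha, Real.sq_sqrt hb, mul_nonneg (Real.sqrt_nonneg a) (Real.sqrt_nonneg b)]

lemma pdist_nonneg (p q : PSp n) : 0 ≤ pdist p q :=
  le_max_of_le_left dist_nonneg

lemma pdist_self (p : PSp n) : pdist p p = 0 := by simp [pdist]

lemma pdist_comm (p q : PSp n) : pdist p q = pdist q p := by
  simp [pdist, dist_comm]

lemma pdist_triangle (p q r : PSp n) : pdist p r ≤ pdist p q + pdist q r := by
  refine max_le ?_ ?_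
  · exact (dist_triangle _ q.1 _).trans (add_le_add (le_max_left _ _) (le_max_left _ _))
  · refine (Real.sqrt_le_sqrt (dist_triangle _ q.2 _)).trans ?_
    refine (sqrt_add_le_sqrt_add_sqrt dist_nonneg dist_nonneg).trans ?_
    exact add_le_add (le_max_right _ _) (le_max_right _ _)

lemma continuous_pdist_left (q : PSp n) : Continuous fun p : PSp n => pdist p q := by
  unfold pdist
  fun_prop

lemma eq_of_pdist_eq_zero {p q : PSp n} (h : pdist p q = 0) : p = q := by
  have h1 : dist p.1 q.1 ≤ 0 := h ▸ le_max_left _ _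
  have h2 : Real.sqrt (dist p.2 q.2) ≤ 0 := h ▸ le_max_right _ _
  have h3 : dist p.2 q.2 ≤ 0 := Real.sqrt_eq_zero'.1 (le_antisymm h2 (Real.sqrt_nonneg _))
  exact Prod.ext (dist_le_zero.1 h1) (dist_le_zero.1 h3)

lemma isCompact_setOf_pdist_le (ρ : ℝ) : IsCompact {z : PSp n | pdist z 0 ≤ ρ} := by
  refine (isCompact_closedBall (0 : PSp n) (max ρ (ρ ^ 2))).of_isClosed_subset
    (isClosed_le (continuous_pdist_left 0) continuous_const) fun z hz => ?_
  have h1 : dist z.1 (0 : PSp n).1 ≤ ρ := (le_max_left _ _).trans hz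
  have h2 : Real.sqrt (dist z.2 (0 : PSp n).2) ≤ ρ := (le_max_right _ _).trans hz
  rw [Metric.mem_closedBall, Prod.dist_eq]
  exact max_le_max h1 (Real.sqrt_le_left (Real.sqrt_nonneg _ |>.trans h2) |>.1 h2)

lemma pdist_pdil_sub {r : ℝ} (hr : 0 < r) (a p q : PSp n) :
    pdist p q = r * pdist (pdil r (p - a)) (pdil r (q - a)) := by
  have h1 : dist (pdil r (p - a)).1 (pdil r (q - a)).1 = r⁻¹ * dist p.1 q.1 := by
    simp [pdil, dist_smul₀, abs_of_pos hr]
  have h2 : dist (pdil r (p - a)).2 (pdil r (q - a)).2 = dist p.2 q.2 / r ^ 2 := by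
    simp only [pdil, Real.dist_eq, Prod.snd_sub]
    rw [← sub_div, abs_div, abs_of_pos (pow_pos hr 2)]
    congr 2
    ring
  rw [pdist, pdist, h1, h2, Real.sqrt_div dist_nonneg, Real.sqrt_sq hr.le, mul_max_of_nonneg _ _ hr.le,
    mul_inv_cancel_left₀ hr.ne', mul_div_cancel₀ _ hr.ne']

end ParabolicMetric

section ParabolicDiameter

variable {n : ℕ}

lemma ofReal_pdist_le_pdiam {s : Set (PSp n)} {p q : PSp n} (hp : p ∈ s) (hq : q ∈ s) :
    ENNReal.ofReal (pdist p q) ≤ pdiam s :=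
  le_iSup₂_of_le p hp (le_iSup₂_of_le q hq le_rfl)

lemma pdiam_le {s : Set (PSp n)} {d : ENNReal}
    (h : ∀ p ∈ s, ∀ q ∈ s, ENNReal.ofReal (pdist p q) ≤ d) : pdiam s ≤ d :=
  iSup₂_le fun p hp => iSup₂_le fun q hq => h p hp q hq

lemma pdiam_empty : pdiam (∅ : Set (PSp n)) = 0 := by simp [pdiam]

lemma pdiam_mono {s t : Set (PSp n)} (h : s ⊆ t) : pdiam s ≤ pdiam t :=
  pdiam_le fun _ hp _ hq => ofReal_pdist_le_pdiam (h hp) (h hq)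

lemma pdiam_preimage_pdil_le {r : ℝ} (hr : 0 < r) (a : PSp n) (s : Set (PSp n)) :
    pdiam ((fun q => pdil r (q - a)) ⁻¹' s) ≤ ENNReal.ofReal r * pdiam s := by
  refine pdiam_le fun p hp q hq => ?_
  rw [pdist_pdil_sub hr a, ENNReal.ofReal_mul hr.le]
  gcongr
  exact ofReal_pdist_le_pdiam hp hq

/-- The open parabolic neighbourhood of radius `t` of a set. -/
def pthick (t : ℝ) (s : Set (PSp n)) : Set (PSp n) := {q | ∃ x ∈ s, pdist q x < t}

lemma isOpen_pthick (t : ℝ) (s : Set (PSp n)) : IsOpen (pthick t s) := by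
  have : pthick t s = ⋃ x ∈ s, {q | pdist q x < t} := by
    ext q
    simp [pthick]
  rw [this]
  exact isOpen_biUnion fun x _ => isOpen_lt (continuous_pdist_left x) continuous_const

lemma subset_pthick {t : ℝ} (ht : 0 < t) (s : Set (PSp n)) : s ⊆ pthick t s :=
  fun x hx => ⟨x, hx, by rwa [pdist_self]⟩

lemma pdiam_pthick_le {t : ℝ} (ht : 0 ≤ t) (s : Set (PSp n)) :
    pdiam (pthick t s) ≤ pdiam s + ENNReal.ofReal (2 * t) := by
  refine pdiam_le ?_
  rintro p ⟨x, hx, hpx⟩ q ⟨y, hy, hqy⟩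
  have h : pdist p q ≤ pdist x y + 2 * t := by
    have h1 := pdist_triangle p x q
    have h2 := pdist_triangle x y q
    rw [pdist_comm y q] at h2
    linarith
  refine (ENNReal.ofReal_le_ofReal h).trans ?_
  rw [ENNReal.ofReal_add (pdist_nonneg _ _) (by positivity)]
  gcongr
  exact ofReal_pdist_le_pdiam hx hy

lemma exists_isOpen_superset_pdiam_rpow_le {β : ℝ} (hβ : 0 < β) (s : Set (PSp n)) {ε : ENNReal}
    (hε : ε ≠ 0) : ∃ U, IsOpen U ∧ s ⊆ U ∧ pdiam U ^ β ≤ pdiam s ^ β + ε := by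
  by_cases htop : pdiam s ^ β = ⊤
  · exact ⟨Set.univ, isOpen_univ, Set.subset_univ _, by simp [htop]⟩
  have hcont : Tendsto (fun t : ℝ => (pdiam s + ENNReal.ofReal (2 * t)) ^ β) (𝓝[>] 0)
      (𝓝 (pdiam s ^ β)) := by
    have h : Continuous fun t : ℝ => (pdiam s + ENNReal.ofReal (2 * t)) ^ β := by
      refine ENNReal.continuous_rpow_const.comp ?_
      exact continuous_const.add (ENNReal.continuous_ofReal.comp (by fun_prop))
    simpa using (h.tendsto 0).mono_left nhdsWithin_le_nhds
  have hlt : ∀ᶠ t : ℝ in 𝓝[>] 0, (pdiam s + ENNReal.ofReal (2 * t)) ^ β < pdiam s ^ β + ε :=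
    hcont.eventually_lt_const (ENNReal.lt_add_right htop hε)
  obtain ⟨t, ht, ht0⟩ := (hlt.and self_mem_nhdsWithin).exists
  have ht0 : 0 < t := ht0
  exact ⟨pthick t s, isOpen_pthick t s, subset_pthick ht0 s,
    (ENNReal.rpow_le_rpow (pdiam_pthick_le ht0.le s) hβ.le).trans ht.le⟩

end ParabolicDiameter

section ParabolicContent

variable {n : ℕ}

open Classical in
/-- The gauge `diam^β` restricted to sets of parabolic diameter less than `δ`. -/
noncomputable def pgauge (β : ℝ) (δ : ENNReal) (s : Set (PSp n)) : ENNReal :=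
  if pdiam s < δ then pdiam s ^ β else ⊤

lemma rpow_pdiam_le_pgauge (β : ℝ) (δ : ENNReal) (s : Set (PSp n)) :
    pdiam s ^ β ≤ pgauge β δ s := by
  unfold pgauge
  split_ifs <;> simp

lemma pgauge_of_lt {β : ℝ} {δ : ENNReal} {s : Set (PSp n)} (h : pdiam s < δ) :
    pgauge β δ s = pdiam s ^ β := if_pos h

lemma pgauge_anti (β : ℝ) {δ δ' : ENNReal} (h : δ ≤ δ') (s : Set (PSp n)) :
    pgauge β δ' s ≤ pgauge β δ s := by
  by_cases hs : pdiam s < δ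
  · rw [pgauge_of_lt hs, pgauge_of_lt (hs.trans_le h)]
  · simp [pgauge, hs]

lemma pgauge_empty {β : ℝ} (hβ : 0 < β) {δ : ENNReal} (hδ : 0 < δ) :
    pgauge β δ (∅ : Set (PSp n)) = 0 := by
  rw [pgauge_of_lt (by rwa [pdiam_empty]), pdiam_empty, ENNReal.zero_rpow_of_pos hβ]

/-- The parabolic Hausdorff premeasure as an outer measure; `δ = ∞` gives the content. -/
noncomputable def pcontent (n : ℕ) {β : ℝ} (hβ : 0 < β) {δ : ENNReal} (hδ : 0 < δ) :
    OuterMeasure (PSp n) :=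
  OuterMeasure.ofFunction (pgauge β δ) (pgauge_empty hβ hδ)

variable {β : ℝ} (hβ : 0 < β)

lemma pcontent_le_pgauge {δ : ENNReal} (hδ : 0 < δ) (s : Set (PSp n)) :
    pcontent n hβ hδ s ≤ pgauge β δ s :=
  OuterMeasure.ofFunction_le s

lemma pcontent_anti {δ δ' : ENNReal} (hδ : 0 < δ) (hδ' : 0 < δ') (h : δ ≤ δ')
    (s : Set (PSp n)) : pcontent n hβ hδ' s ≤ pcontent n hβ hδ s :=
  OuterMeasure.le_ofFunction.2
    (fun t => (pcontent_le_pgauge hβ hδ' t).trans (pgauge_anti β h t)) s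

lemma exists_cover_of_pcontent_lt {δ : ENNReal} (hδ : 0 < δ) {s : Set (PSp n)} {a : ENNReal}
    (h : pcontent n hβ hδ s < a) :
    ∃ c : ℕ → Set (PSp n), s ⊆ ⋃ i, c i ∧ ∑' i, pgauge β δ (c i) < a := by
  rw [pcontent, OuterMeasure.ofFunction_apply] at h
  simpa only [iInf_lt_iff, exists_prop] using h

lemma pcontent_le_tsum {δ : ENNReal} (hδ : 0 < δ) {s : Set (PSp n)} {c : ℕ → Set (PSp n)}
    (h : s ⊆ ⋃ i, c i) : pcontent n hβ hδ s ≤ ∑' i, pgauge β δ (c i) :=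
  (measure_mono h).trans <| (measure_iUnion_le c).trans <|
    ENNReal.tsum_le_tsum fun i => pcontent_le_pgauge hβ hδ (c i)

lemma pcontent_top_le_tsum {s : Set (PSp n)} {c : ℕ → Set (PSp n)} (h : s ⊆ ⋃ i, c i) :
    pcontent n hβ ENNReal.zero_lt_top s ≤ ∑' i, pdiam (c i) ^ β := by
  refine (pcontent_le_tsum hβ _ h).trans (ENNReal.tsum_le_tsum fun i => ?_)
  by_cases hi : pdiam (c i) < ⊤
  · rw [pgauge_of_lt hi]
  · rw [not_lt_top_iff.1 hi, ENNReal.top_rpow_of_pos hβ]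
    exact le_top

lemma pHpre_eq_pcontent {δ : ℝ} (hδ : 0 < δ) (s : Set (PSp n)) :
    pHpre β δ s = pcontent n hβ (ENNReal.ofReal_pos.2 hδ) s := by
  apply le_antisymm
  · refine le_of_forall_gt fun a ha => ?_
    obtain ⟨c, hc, hsum⟩ := exists_cover_of_pcontent_lt hβ _ ha
    have hlt : ∀ i, pdiam (c i) < ENNReal.ofReal δ := fun i => by
      by_contra hi
      have h := (ENNReal.le_tsum i).trans_lt hsum
      simp [pgauge, hi] at h
    refine (iInf₂_le_of_le c hc (iInf_le_of_le hlt le_rfl)).trans_lt ?_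
    simpa only [pgauge_of_lt (hlt _)] using hsum
  · refine le_iInf₂ fun c hc => le_iInf fun hlt => ?_
    refine (pcontent_le_tsum hβ _ hc).trans_eq ?_
    simp only [pgauge_of_lt (hlt _)]

lemma pH_eq_zero_iff {s : Set (PSp n)} :
    pH β s = 0 ↔ ∀ δ : ENNReal, ∀ hδ : 0 < δ, pcontent n hβ hδ s = 0 := by
  simp only [pH, ENNReal.iSup_eq_zero]
  refine ⟨fun h δ hδ => ?_, fun h δ hδ => ?_⟩
  · obtain ⟨ε, hε0, hε⟩ : ∃ ε : ℝ, 0 < ε ∧ ENNReal.ofReal ε ≤ δ := by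
      obtain ⟨ε, -, h0, h1⟩ := ENNReal.lt_iff_exists_real_btwn.1 hδ
      exact ⟨ε, ENNReal.ofReal_pos.1 h0, h1.le⟩
    have := h ε hε0
    rw [pHpre_eq_pcontent hβ hε0] at this
    exact le_antisymm ((pcontent_anti hβ _ hδ hε s).trans_eq this) zero_le
  · rw [pHpre_eq_pcontent hβ hδ]
    exact h _ _

lemma pcontent_eq_zero_of_subsingleton {δ : ENNReal} (hδ : 0 < δ) {s : Set (PSp n)}
    (hs : s.Subsingleton) : pcontent n hβ hδ s = 0 := by
  have h0 : pdiam s = 0 := le_antisymm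
    (pdiam_le fun p hp q hq => by simp [hs hp hq, pdist_self]) zero_le
  refine le_antisymm ((pcontent_le_pgauge hβ hδ s).trans ?_) zero_le
  rw [pgauge_of_lt (by rwa [h0]), h0, ENNReal.zero_rpow_of_pos hβ]

/-- A cover of content less than `diam^β` automatically consists of sets of smaller diameter. -/
lemma pcontent_le_of_pcontent_top_lt {δ d b : ENNReal} (hδ : 0 < δ) (hd : d < δ) (hb : b ≤ d ^ β)
    {s : Set (PSp n)} (h : pcontent n hβ ENNReal.zero_lt_top s < b) :
    pcontent n hβ hδ s ≤ b := by
  obtain ⟨c, hc, hsum⟩ := exists_cover_of_pcontent_lt hβ _ h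
  have hlt : ∀ i, pdiam (c i) < δ := fun i => by
    have h1 : pdiam (c i) ^ β < d ^ β :=
      ((rpow_pdiam_le_pgauge β ⊤ (c i)).trans (ENNReal.le_tsum i)).trans_lt (hsum.trans_le hb)
    exact ((ENNReal.rpow_lt_rpow_iff hβ).1 h1).trans hd
  refine (pcontent_le_tsum hβ hδ hc).trans (le_trans ?_ hsum.le)
  refine ENNReal.tsum_le_tsum fun i => ?_
  rw [pgauge_of_lt (hlt i)]
  exact rpow_pdiam_le_pgauge β ⊤ (c i)

end ParabolicContent

section Density

variable {n : ℕ} {β : ℝ} (hβ : 0 < β)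

/-- The density constant `2^{-β}/4`. -/
noncomputable def pdensConst (β : ℝ) : ENNReal := ((2 : ENNReal) ^ β)⁻¹ * 4⁻¹

lemma pdensConst_ne_zero (β : ℝ) : pdensConst β ≠ 0 := by
  simp [pdensConst]

lemma pcontent_inter_le_half {A : Set (PSp n)} {ρ : ℝ} (hρ : 0 < ρ)
    (hA : ∀ x ∈ A, ∀ r : ℝ, 0 < r → r < ρ →
      pcontent n hβ ENNReal.zero_lt_top (A ∩ {q | pdist q x < r}) ≤
        pdensConst β * ENNReal.ofReal r ^ β)
    {δ : ENNReal} (hδ : 0 < δ) (hδρ : δ ≤ ENNReal.ofReal (ρ / 2)) {C : Set (PSp n)}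
    (hC : pdiam C < δ) : pcontent n hβ hδ (A ∩ C) ≤ 2⁻¹ * pdiam C ^ β := by
  rcases (A ∩ C).eq_empty_or_nonempty with hne | ⟨x, hxA, hxC⟩
  · simp [hne]
  have hfin : pdiam C ≠ ⊤ := hC.ne_top
  by_cases h0 : pdiam C = 0
  · have hs : (A ∩ C).Subsingleton := fun p hp q hq => by
      have h := ofReal_pdist_le_pdiam hp.2 hq.2
      rw [h0] at h
      exact eq_of_pdist_eq_zero
        (le_antisymm (ENNReal.ofReal_eq_zero.1 (le_antisymm h zero_le)) (pdist_nonneg _ _))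
    rw [pcontent_eq_zero_of_subsingleton hβ hδ hs]
    exact zero_le
  set d := (pdiam C).toReal with hd
  have hdC : ENNReal.ofReal d = pdiam C := ENNReal.ofReal_toReal hfin
  have hd0 : 0 < d := ENNReal.toReal_pos h0 hfin
  have hdρ : 2 * d < ρ := by
    have h1 : ENNReal.ofReal d < ENNReal.ofReal (ρ / 2) := hdC ▸ hC.trans_le hδρ
    have := (ENNReal.ofReal_lt_ofReal_iff (by positivity)).1 h1
    linarith
  have hdβ0 : pdiam C ^ β ≠ 0 := by simp [ENNReal.rpow_eq_zero_iff, h0, hfin]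
  have hdβt : pdiam C ^ β ≠ ⊤ := ENNReal.rpow_ne_top_of_nonneg hβ.le hfin
  have hsub : A ∩ C ⊆ A ∩ {q | pdist q x < 2 * d} := fun q hq => by
    refine ⟨hq.1, ?_⟩
    have h := ofReal_pdist_le_pdiam hq.2 hxC
    rw [← hdC, ENNReal.ofReal_le_ofReal_iff hd0.le] at h
    change pdist q x < 2 * d
    linarith
  have hcont : pcontent n hβ ENNReal.zero_lt_top (A ∩ C) ≤ 4⁻¹ * pdiam C ^ β := by
    refine (measure_mono hsub).trans ((hA x hxA (2 * d) (by positivity) hdρ).trans_eq ?_)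
    rw [ENNReal.ofReal_mul zero_le_two, hdC, ENNReal.mul_rpow_of_nonneg _ _ hβ.le, pdensConst,
      ENNReal.ofReal_ofNat, mul_comm _ (4 : ENNReal)⁻¹, mul_assoc, ← mul_assoc _ _ (pdiam C ^ β),
      ENNReal.inv_mul_cancel (by simp) (by simp), one_mul]
  refine pcontent_le_of_pcontent_top_lt hβ hδ hC ?_ (hcont.trans_lt ?_)
  · exact mul_le_of_le_one_left zero_le (by simp)
  · exact (ENNReal.mul_lt_mul_iff_left hdβ0 hdβt).2 (ENNReal.inv_lt_inv.2 (by norm_num))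

/-- A set whose parabolic content has small density at all its points and all small scales is
null for the parabolic Hausdorff measure. -/
lemma pcontent_eq_zero_of_density_le {A : Set (PSp n)} {ρ : ℝ} (hρ : 0 < ρ)
    (hA : ∀ x ∈ A, ∀ r : ℝ, 0 < r → r < ρ →
      pcontent n hβ ENNReal.zero_lt_top (A ∩ {q | pdist q x < r}) ≤
        pdensConst β * ENNReal.ofReal r ^ β)
    {δ : ENNReal} (hδ : 0 < δ) : pcontent n hβ hδ A = 0 := by
  have hη : 0 < min δ (ENNReal.ofReal (ρ / 2)) :=
    lt_min hδ (ENNReal.ofReal_pos.2 (by positivity))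
  set η := min δ (ENNReal.ofReal (ρ / 2)) with hηdef
  have hηtop : η ≠ ⊤ := ((min_le_right _ _).trans_lt ENNReal.ofReal_lt_top).ne
  suffices pcontent n hβ hη A = 0 from
    le_antisymm ((pcontent_anti hβ hη hδ (min_le_left _ _) A).trans_eq this) zero_le
  have hhalf : ∀ A' ⊆ A, pcontent n hβ hη A' ≤ 2⁻¹ * pcontent n hβ hη A' := fun A' hA' => by
    rw [← ENNReal.div_eq_inv_mul, ENNReal.le_div_iff_mul_le (by simp) (by simp)]
    refine le_of_forall_gt fun a ha => ?_
    obtain ⟨c, hc, hsum⟩ := exists_cover_of_pcontent_lt hβ hη ha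
    refine lt_of_le_of_lt ?_ hsum
    rw [← ENNReal.le_div_iff_mul_le (by simp) (by simp), ENNReal.div_eq_inv_mul,
      ← ENNReal.tsum_mul_left]
    have hcov : A' ⊆ ⋃ i, A ∩ c i := by
      rw [← Set.inter_iUnion]
      exact Set.subset_inter hA' hc
    refine (measure_mono hcov).trans ((measure_iUnion_le _).trans ?_)
    refine ENNReal.tsum_le_tsum fun i => ?_
    by_cases hi : pdiam (c i) < η
    · rw [pgauge_of_lt hi]
      exact pcontent_inter_le_half hβ hρ hA hη (min_le_right _ _) hi
    · simp [pgauge, hi]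
  obtain ⟨t, ht0, ht⟩ : ∃ t : ℝ, 0 < t ∧ ENNReal.ofReal (2 * t) < η := by
    obtain ⟨ε, -, h0, h1⟩ := ENNReal.lt_iff_exists_real_btwn.1 hη
    exact ⟨ε / 2, half_pos (ENNReal.ofReal_pos.1 h0), by rwa [mul_div_cancel₀ _ two_ne_zero]⟩
  have hcover : A ⊆ ⋃ i, A ∩ pthick t {TopologicalSpace.denseSeq (PSp n) i} := fun x hx => by
    obtain ⟨q, hq, i, rfl⟩ := (TopologicalSpace.denseRange_denseSeq (PSp n)).inter_open_nonempty
      {q | pdist q x < t} (isOpen_lt (continuous_pdist_left x) continuous_const)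
      ⟨x, by simpa [pdist_self] using ht0⟩
    exact Set.mem_iUnion.2 ⟨i, hx, _, rfl, by rw [pdist_comm]; exact hq⟩
  refine measure_mono_null hcover (measure_iUnion_null fun i => ?_)
  have hdiam : pdiam (A ∩ pthick t {TopologicalSpace.denseSeq (PSp n) i}) < η := by
    refine ((pdiam_mono Set.inter_subset_right).trans (pdiam_pthick_le ht0.le _)).trans_lt ?_
    have : pdiam {TopologicalSpace.denseSeq (PSp n) i} = 0 := le_antisymm
      (pdiam_le fun p hp q hq => by
        simp [Set.mem_singleton_iff.1 hp, Set.mem_singleton_iff.1 hq, pdist_self]) zero_le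
    rwa [this, zero_add]
  by_contra hne
  have hlt : pcontent n hβ hη (A ∩ pthick t {TopologicalSpace.denseSeq (PSp n) i}) < ⊤ := by
    refine (pcontent_le_pgauge hβ hη _).trans_lt ?_
    rw [pgauge_of_lt hdiam]
    exact (ENNReal.rpow_ne_top_of_nonneg hβ.le hdiam.ne_top).lt_top
  have h := hhalf _ (Set.inter_subset_left (t := pthick t {TopologicalSpace.denseSeq (PSp n) i}))
  rw [← ENNReal.div_eq_inv_mul] at h
  exact absurd h (ENNReal.half_lt_self hne hlt.ne).not_ge

end Density

section Accumulation

variable {n : ℕ}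

/-- The rescalings of `E` are eventually contained in any open neighbourhood of the accumulation
set. -/
lemma eventually_rescaling_subset {E : Set (PSp n)} {p : PSp n} {r : ℕ → ℝ} {U : Set (PSp n)}
    (hU : IsOpen U) (h : accSet E p r ⊆ U) :
    ∀ᶠ j in atTop, (pdil (r j) '' ((fun q => q - p) '' E)) ∩ {q | pdist q 0 < 1 / 2} ⊆ U := by
  by_contra hcon
  obtain ⟨φ, hφ, hnot⟩ := extraction_of_frequently_atTop (not_eventually.1 hcon)
  simp only [Set.not_subset] at hnot
  choose z hz hzU using hnot
  obtain ⟨a, ha, ψ, hψ, hlim⟩ := (isCompact_setOf_pdist_le (n := n) (1 / 2)).tendsto_subseq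
    fun l => (le_of_lt (hz l).2 : pdist (z l) 0 ≤ 1 / 2)
  have haU : a ∈ Uᶜ := hU.isClosed_compl.mem_of_tendsto hlim (Eventually.of_forall fun l => hzU _)
  refine haU (h ⟨ha, φ ∘ ψ, z ∘ ψ, (hφ.comp hψ).tendsto_atTop, fun l => hz _, ?_⟩)
  simpa [pdist_self, Function.comp_def] using ((continuous_pdist_left a).tendsto a).comp hlim

lemma pcontent_ball_le_of_rescaling_subset {β : ℝ} (hβ : 0 < β) {E : Set (PSp n)} {p : PSp n}
    {s : ℝ} (hs : 0 < s) {c : ℕ → Set (PSp n)}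
    (h : (pdil (2 * s) '' ((fun q => q - p) '' E)) ∩ {q | pdist q 0 < 1 / 2} ⊆ ⋃ i, c i) :
    pcontent n hβ ENNReal.zero_lt_top (E ∩ {q | pdist q p < s}) ≤
      ENNReal.ofReal (2 * s) ^ β * ∑' i, pdiam (c i) ^ β := by
  have h2s : 0 < 2 * s := by positivity
  have hcov : E ∩ {q | pdist q p < s} ⊆ ⋃ i, (fun q => pdil (2 * s) (q - p)) ⁻¹' c i := by
    rintro q ⟨hqE, hq⟩
    rw [← Set.preimage_iUnion]
    refine h ⟨⟨_, ⟨q, hqE, rfl⟩, rfl⟩, ?_⟩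
    have h1 := pdist_pdil_sub h2s p q p
    have h2 : pdil (2 * s) (p - p) = 0 := by simp [pdil]
    rw [h2] at h1
    have hq : pdist q p < s := hq
    rw [h1] at hq
    change pdist (pdil (2 * s) (q - p)) 0 < 1 / 2
    nlinarith
  refine (pcontent_top_le_tsum hβ hcov).trans ?_
  rw [← ENNReal.tsum_mul_left]
  refine ENNReal.tsum_le_tsum fun i => ?_
  rw [← ENNReal.mul_rpow_of_nonneg _ _ hβ.le]
  exact ENNReal.rpow_le_rpow (pdiam_preimage_pdil_le h2s p (c i)) hβ.le

/-- If `E` has large content in the balls of radii `s j` around `p`, then blowing up at the scales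
`2 * s j` yields an accumulation set of positive measure. -/
lemma pH_accSet_pos {β : ℝ} (hβ : 0 < β) {E : Set (PSp n)} {p : PSp n} {s : ℕ → ℝ}
    (hs : ∀ j, 0 < s j) {κ : ENNReal} (hκ : κ ≠ 0)
    (hlarge : ∀ j, κ * ENNReal.ofReal (s j) ^ β <
      pcontent n hβ ENNReal.zero_lt_top (E ∩ {q | pdist q p < s j})) :
    0 < pH β (accSet E p fun j => 2 * s j) := by
  refine pos_iff_ne_zero.2 fun hzero => ?_
  have hcz := (pH_eq_zero_iff hβ).1 hzero ⊤ ENNReal.zero_lt_top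
  have h2t : (2 : ENNReal) ^ β ≠ ⊤ := ENNReal.rpow_ne_top_of_nonneg hβ.le (by simp)
  have hη : κ / 2 ^ β / 2 ≠ 0 := by
    simp [ENNReal.div_eq_zero_iff, hκ, h2t]
  obtain ⟨c, hc, hsum⟩ := exists_cover_of_pcontent_lt hβ _ (hcz.trans_lt (pos_iff_ne_zero.2 hη))
  obtain ⟨ε, hε0, hε⟩ := ENNReal.exists_pos_sum_of_countable' hη ℕ
  choose U hUo hcU hU using fun i =>
    exists_isOpen_superset_pdiam_rpow_le hβ (c i) (hε0 i).ne'
  have hUsum : ∑' i, pdiam (U i) ^ β ≤ κ / 2 ^ β := by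
    calc ∑' i, pdiam (U i) ^ β ≤ ∑' i, (pgauge β ⊤ (c i) + ε i) :=
          ENNReal.tsum_le_tsum fun i => (hU i).trans
            (add_le_add_left (rpow_pdiam_le_pgauge β ⊤ (c i)) _)
      _ = ∑' i, pgauge β ⊤ (c i) + ∑' i, ε i := ENNReal.tsum_add
      _ ≤ κ / 2 ^ β / 2 + κ / 2 ^ β / 2 := add_le_add hsum.le hε.le
      _ = κ / 2 ^ β := ENNReal.add_halves _
  obtain ⟨j, hj⟩ := (eventually_rescaling_subset (isOpen_iUnion hUo)
    (hc.trans (Set.iUnion_mono hcU))).exists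
  refine (hlarge j).not_ge ((pcontent_ball_le_of_rescaling_subset hβ (hs j) hj).trans ?_)
  rw [ENNReal.ofReal_mul zero_le_two, ENNReal.mul_rpow_of_nonneg _ _ hβ.le, ENNReal.ofReal_ofNat]
  calc (2 : ENNReal) ^ β * ENNReal.ofReal (s j) ^ β * ∑' i, pdiam (U i) ^ β
      ≤ (2 : ENNReal) ^ β * ENNReal.ofReal (s j) ^ β * (κ / 2 ^ β) := by gcongr
    _ = 2 ^ β * (κ / 2 ^ β) * ENNReal.ofReal (s j) ^ β := by ring
    _ ≤ κ * ENNReal.ofReal (s j) ^ β := by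
      gcongr
      exact ENNReal.mul_div_le

lemma exists_strictAnti_seq_of_frequently {P : ℝ → Prop} (h : ∃ᶠ s in 𝓝[>] (0 : ℝ), P s) :
    ∃ s : ℕ → ℝ, (∀ j, 0 < s j) ∧ StrictAnti s ∧ Tendsto s atTop (𝓝 0) ∧ ∀ j, P (s j) := by
  obtain ⟨u, hu, hP⟩ := exists_seq_forall_of_frequently (h.and_eventually self_mem_nhdsWithin)
  obtain ⟨φ, hφ, hmono⟩ := strictMono_subseq_of_tendsto_atTop (tendsto_inv_nhdsGT_zero.comp hu)
  have hpos : ∀ j, 0 < u j := fun j => (hP j).2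
  refine ⟨u ∘ φ, fun j => hpos _, fun i j hij => ?_, ?_, fun j => (hP _).1⟩
  · exact (inv_lt_inv₀ (hpos _) (hpos _)).1 (hmono hij)
  · exact (tendsto_nhds_of_tendsto_nhdsWithin hu).comp hφ.tendsto_atTop

end Accumulation

/-- Lemma 2.1 of the paper, a parabolic variant of
Figalli–Serra, Lemma 3.5. If `H^β_P(E) > 0` with `β ∈ (0, n+2]`, then for `H^β_P`-a.e.
`p₀ ∈ E` there is a sequence `r_j ↓ 0` whose accumulation set has positive `H^β_P` measure;
i.e. the set of points of `E` where this fails is `H^β_P`-null. -/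
theorem stmt4 (n : ℕ) (hn : 1 ≤ n) (β : ℝ) (hβ0 : 0 < β) (hβ : β ≤ (n : ℝ) + 2)
    (E : Set (PSp n)) (hE : 0 < pH β E) :
    pH β {p₀ ∈ E | ¬ ∃ r : ℕ → ℝ, (∀ j, 0 < r j) ∧ StrictAnti r ∧
        Tendsto r atTop (𝓝 0) ∧ 0 < pH β (accSet E p₀ r)} = 0 := by
  rw [pH_eq_zero_iff hβ0]
  intro δ hδ
  set A : ℕ → Set (PSp n) := fun k => {p ∈ E | ∀ r : ℝ, 0 < r → r < 1 / ((k : ℝ) + 1) →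
    pcontent n hβ0 ENNReal.zero_lt_top (E ∩ {q | pdist q p < r}) ≤
      pdensConst β * ENNReal.ofReal r ^ β} with hA
  have hnull : ∀ k, pcontent n hβ0 hδ (A k) = 0 := fun k =>
    pcontent_eq_zero_of_density_le hβ0 Nat.one_div_pos_of_nat
      (fun x hx r hr0 hr => (measure_mono (Set.inter_subset_inter_left _ fun q hq => hq.1)).trans
        (hx.2 r hr0 hr)) hδ
  refine measure_mono_null ?_ (measure_iUnion_null hnull)
  rintro p ⟨hpE, hbad⟩
  have hev : ∀ᶠ r in 𝓝[>] (0 : ℝ),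
      pcontent n hβ0 ENNReal.zero_lt_top (E ∩ {q | pdist q p < r}) ≤
        pdensConst β * ENNReal.ofReal r ^ β := by
    by_contra hcon
    obtain ⟨s, hs0, hsa, hst, hs⟩ :=
      exists_strictAnti_seq_of_frequently (not_eventually.1 hcon)
    refine hbad ⟨fun j => 2 * s j, fun j => mul_pos two_pos (hs0 j),
      fun i j hij => mul_lt_mul_of_pos_left (hsa hij) two_pos, by simpa using hst.const_mul 2, ?_⟩
    exact pH_accSet_pos hβ0 hs0 (pdensConst_ne_zero β) fun j => not_le.1 (hs j)
  obtain ⟨ρ, hρ0, hρ⟩ := mem_nhdsGT_iff_exists_Ioo_subset.1 hev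
  obtain ⟨k, hk⟩ := exists_nat_one_div_lt (Set.mem_Ioi.1 hρ0)
  exact Set.mem_iUnion.2 ⟨k, hpE, fun r hr0 hr => hρ ⟨hr0, hr.trans hk⟩⟩
end

section
/- Let a, b ∈ ℝ with a + 1 < b. Let (λ_j)_{j∈ℕ} be real numbers with λ_j ≥ −1 for all j, and let (a_j)_{j∈ℕ} be real numbers, not all zero, such that F(τ) := Σ_j a_j² e^{−2λ_j τ} is finite for every τ ∈ (a, b). Define the decay order N(τ) := (1/2) log( F(τ) / F(τ+1) ) for τ ∈ (a, b−1). Then: (i) N(τ) ≥ −1 for all τ ∈ (a, b−1), and N is nonincreasing on (a, b−1); (ii) for γ ∈ ℝ: if a_j = 0 whenever λ_j < γ then N(τ) ≥ γ for all τ ∈ (a, b−1); if a_j = 0 whenever λ_j > γ then N(τ) ≤ γ; and if a_j = 0 whenever λ_j ≠ γ then N(τ) = γ; (iii) if N(τ₁) = N(τ₂) = γ for some τ₁ < τ₂ in (a, b−1), then a_j = 0 for every j with λ_j ≠ γ, so that F(τ) = c e^{−2γτ} for a constant c > 0. -/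
open Real Set Filter Topology

/-- `F(τ) = Σ_j a_j² e^{−2 λ_j τ}`, the squared Gaussian `L²` norm of a parabolic Jacobi
field `Σ_j a_j e^{−λ_j τ} φ_j` expanded in an orthonormal eigenbasis. -/
noncomputable def Fsum (a lam : ℕ → ℝ) (τ : ℝ) : ℝ :=
  ∑' j, (a j) ^ 2 * Real.exp (-2 * lam j * τ)

/-- The (linear) decay order `N(τ) = (1/2) log( F(τ)/F(τ+1) )`. -/
noncomputable def Nord (a lam : ℕ → ℝ) (τ : ℝ) : ℝ :=
  (1 / 2) * Real.log (Fsum a lam τ / Fsum a lam (τ + 1))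

theorem Fsum_pos {a lam : ℕ → ℝ} {τ : ℝ} (ha : ∃ j, a j ≠ 0)
    (h : Summable fun j => (a j) ^ 2 * Real.exp (-2 * lam j * τ)) : 0 < Fsum a lam τ := by
  obtain ⟨j, hj⟩ := ha
  exact h.tsum_pos (fun i => by positivity) j (by positivity)

theorem Nord_le_iff {a lam : ℕ → ℝ} {τ γ : ℝ} (h₀ : 0 < Fsum a lam τ)
    (h₁ : 0 < Fsum a lam (τ + 1)) :
    Nord a lam τ ≤ γ ↔ Real.exp (-2 * γ) * Fsum a lam τ ≤ Fsum a lam (τ + 1) := by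
  have hN : Nord a lam τ ≤ γ ↔ Real.log (Fsum a lam τ / Fsum a lam (τ + 1)) ≤ 2 * γ := by
    unfold Nord
    constructor <;> intro h <;> linarith
  rw [hN, Real.log_le_iff_le_exp (by positivity), div_le_iff₀ h₁, neg_mul, Real.exp_neg,
    inv_mul_le_iff₀ (Real.exp_pos _)]

theorem le_Nord_iff {a lam : ℕ → ℝ} {τ γ : ℝ} (h₀ : 0 < Fsum a lam τ)
    (h₁ : 0 < Fsum a lam (τ + 1)) :
    γ ≤ Nord a lam τ ↔ Fsum a lam (τ + 1) ≤ Real.exp (-2 * γ) * Fsum a lam τ := by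
  have hN : γ ≤ Nord a lam τ ↔ 2 * γ ≤ Real.log (Fsum a lam τ / Fsum a lam (τ + 1)) := by
    unfold Nord
    constructor <;> intro h <;> linarith
  rw [hN, Real.le_log_iff_exp_le (by positivity), le_div_iff₀ h₁, neg_mul, Real.exp_neg,
    le_inv_mul_iff₀ (Real.exp_pos _)]

/-- The product of two exponential differences compared at the same rates `x`, `y` is positive
unless `x = y`. -/
theorem exp_sub_exp_mul_pos {x y d : ℝ} (hd : 0 < d) (hxy : x ≠ y) :
    0 < (Real.exp (-2 * x) - Real.exp (-2 * y)) *
      (Real.exp (-2 * x * d) - Real.exp (-2 * y * d)) := by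
  rcases lt_or_gt_of_ne hxy with h | h
  · exact mul_pos (sub_pos.2 (Real.exp_lt_exp.2 (by linarith)))
      (sub_pos.2 (Real.exp_lt_exp.2 (by nlinarith)))
  · exact mul_pos_of_neg_of_neg (sub_neg.2 (Real.exp_lt_exp.2 (by linarith)))
      (sub_neg.2 (Real.exp_lt_exp.2 (by nlinarith)))

theorem exp_sub_exp_mul_nonneg {x y d : ℝ} (hd : 0 < d) :
    0 ≤ (Real.exp (-2 * x) - Real.exp (-2 * y)) *
      (Real.exp (-2 * x * d) - Real.exp (-2 * y * d)) := by
  rcases eq_or_ne x y with rfl | h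
  · simp
  · exact (exp_sub_exp_mul_pos hd h).le

/-- The change of `F(τ + 1) - e^{-2γ} F(τ)` between two times, weighted by `e^{-2γd}`, as a
series of nonnegative terms. -/
theorem hasSum_Fsum_sub {a lam : ℕ → ℝ} {τ d γ : ℝ}
    (h₀ : Summable fun j => (a j) ^ 2 * Real.exp (-2 * lam j * τ))
    (h₁ : Summable fun j => (a j) ^ 2 * Real.exp (-2 * lam j * (τ + 1)))
    (h₂ : Summable fun j => (a j) ^ 2 * Real.exp (-2 * lam j * (τ + d)))
    (h₃ : Summable fun j => (a j) ^ 2 * Real.exp (-2 * lam j * (τ + d + 1))) :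
    HasSum (fun j => (a j) ^ 2 * Real.exp (-2 * lam j * τ) *
        ((Real.exp (-2 * lam j) - Real.exp (-2 * γ)) *
          (Real.exp (-2 * lam j * d) - Real.exp (-2 * γ * d))))
      ((Fsum a lam (τ + d + 1) - Real.exp (-2 * γ) * Fsum a lam (τ + d)) -
        Real.exp (-2 * γ * d) *
          (Fsum a lam (τ + 1) - Real.exp (-2 * γ) * Fsum a lam τ)) := by
  have h := (h₃.hasSum.sub (h₂.hasSum.mul_left (Real.exp (-2 * γ)))).sub
    ((h₁.hasSum.sub (h₀.hasSum.mul_left (Real.exp (-2 * γ)))).mul_left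
      (Real.exp (-2 * γ * d)))
  refine (congrArg (HasSum · _) (funext fun j => ?_)).mp h
  simp only [mul_add, mul_one, Real.exp_add]
  ring

/-- eigenfunction-expansion form of Lemma B.4 of the paper.
Let `s + 1 < t`, `λ_j ≥ −1`, `(a_j)` not all zero, with `F(τ) = Σ a_j² e^{−2λ_jτ}` finite on
`(s,t)`. Then (i) the decay order `N` satisfies `N ≥ −1` and is nonincreasing on `(s, t−1)`;
(ii) vanishing of low (resp. high, resp. off-`γ`) modes forces `N ≥ γ` (resp. `≤ γ`, `= γ`);
(iii) if `N(τ₁) = N(τ₂) = γ` with `τ₁ < τ₂`, then all modes with `λ_j ≠ γ` vanish and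
`F(τ) = c e^{−2γτ}` for some `c > 0`. -/
theorem stmt10 (s t : ℝ) (hst : s + 1 < t) (lam a : ℕ → ℝ)
    (hlam : ∀ j, -1 ≤ lam j) (ha : ∃ j, a j ≠ 0)
    (hsum : ∀ τ ∈ Ioo s t, Summable (fun j => (a j) ^ 2 * Real.exp (-2 * lam j * τ))) :
    ((∀ τ ∈ Ioo s (t - 1), -1 ≤ Nord a lam τ) ∧ AntitoneOn (Nord a lam) (Ioo s (t - 1))) ∧
    (∀ γ : ℝ,
      ((∀ j, lam j < γ → a j = 0) → ∀ τ ∈ Ioo s (t - 1), γ ≤ Nord a lam τ) ∧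
      ((∀ j, γ < lam j → a j = 0) → ∀ τ ∈ Ioo s (t - 1), Nord a lam τ ≤ γ) ∧
      ((∀ j, lam j ≠ γ → a j = 0) → ∀ τ ∈ Ioo s (t - 1), Nord a lam τ = γ)) ∧
    (∀ γ : ℝ, ∀ τ₁ ∈ Ioo s (t - 1), ∀ τ₂ ∈ Ioo s (t - 1), τ₁ < τ₂ →
      Nord a lam τ₁ = γ → Nord a lam τ₂ = γ →
      (∀ j, lam j ≠ γ → a j = 0) ∧
      ∃ c : ℝ, 0 < c ∧ ∀ τ : ℝ, Fsum a lam τ = c * Real.exp (-2 * γ * τ)) := by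
  have mem₀ : ∀ τ ∈ Ioo s (t - 1), τ ∈ Ioo s t := fun τ hτ => ⟨hτ.1, by linarith [hτ.2]⟩
  have mem₁ : ∀ τ ∈ Ioo s (t - 1), τ + 1 ∈ Ioo s t :=
    fun τ hτ => ⟨by linarith [hτ.1], by linarith [hτ.2]⟩
  have pos₀ : ∀ τ ∈ Ioo s (t - 1), 0 < Fsum a lam τ :=
    fun τ hτ => Fsum_pos ha (hsum _ (mem₀ τ hτ))
  have pos₁ : ∀ τ ∈ Ioo s (t - 1), 0 < Fsum a lam (τ + 1) :=
    fun τ hτ => Fsum_pos ha (hsum _ (mem₁ τ hτ))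
  have lower : ∀ γ : ℝ, (∀ j, lam j < γ → a j = 0) →
      ∀ τ ∈ Ioo s (t - 1), γ ≤ Nord a lam τ := by
    intro γ h τ hτ
    rw [le_Nord_iff (pos₀ τ hτ) (pos₁ τ hτ), Fsum, Fsum, ← tsum_mul_left]
    refine (hsum _ (mem₁ τ hτ)).tsum_le_tsum (fun j => ?_) ((hsum _ (mem₀ τ hτ)).mul_left _)
    rcases lt_or_ge (lam j) γ with hj | hj
    · simp [h j hj]
    · rw [mul_left_comm, ← Real.exp_add]
      gcongr
      linarith
  have upper : ∀ γ : ℝ, (∀ j, γ < lam j → a j = 0) →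
      ∀ τ ∈ Ioo s (t - 1), Nord a lam τ ≤ γ := by
    intro γ h τ hτ
    rw [Nord_le_iff (pos₀ τ hτ) (pos₁ τ hτ), Fsum, Fsum, ← tsum_mul_left]
    refine ((hsum _ (mem₀ τ hτ)).mul_left _).tsum_le_tsum (fun j => ?_) (hsum _ (mem₁ τ hτ))
    rcases lt_or_ge γ (lam j) with hj | hj
    · simp [h j hj]
    · rw [mul_left_comm, ← Real.exp_add]
      gcongr
      linarith
  have eq_exp : ∀ τ ∈ Ioo s (t - 1),
      Fsum a lam (τ + 1) = Real.exp (-2 * Nord a lam τ) * Fsum a lam τ := fun τ hτ =>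
    le_antisymm ((le_Nord_iff (pos₀ τ hτ) (pos₁ τ hτ)).1 le_rfl)
      ((Nord_le_iff (pos₀ τ hτ) (pos₁ τ hτ)).1 le_rfl)
  have key : ∀ τ₁ ∈ Ioo s (t - 1), ∀ τ₂ ∈ Ioo s (t - 1),
      HasSum (fun j => (a j) ^ 2 * Real.exp (-2 * lam j * τ₁) *
        ((Real.exp (-2 * lam j) - Real.exp (-2 * Nord a lam τ₁)) *
          (Real.exp (-2 * lam j * (τ₂ - τ₁)) - Real.exp (-2 * Nord a lam τ₁ * (τ₂ - τ₁)))))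
      (Fsum a lam (τ₂ + 1) - Real.exp (-2 * Nord a lam τ₁) * Fsum a lam τ₂) := by
    intro τ₁ h₁ τ₂ h₂
    have h := hasSum_Fsum_sub (d := τ₂ - τ₁) (γ := Nord a lam τ₁)
      (hsum _ (mem₀ _ h₁)) (hsum _ (mem₁ _ h₁))
      (by simpa using hsum _ (mem₀ _ h₂)) (by simpa using hsum _ (mem₁ _ h₂))
    rwa [← eq_exp τ₁ h₁, sub_self, mul_zero, sub_zero, add_sub_cancel] at h
  refine ⟨⟨lower (-1) fun j hj => absurd (hlam j) hj.not_ge, ?_⟩, fun γ => ⟨lower γ, upper γ,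
    fun h τ hτ => le_antisymm (upper γ (fun j hj => h j hj.ne') τ hτ)
      (lower γ (fun j hj => h j hj.ne) τ hτ)⟩, ?_⟩
  · intro τ₁ h₁ τ₂ h₂ h
    rcases h.eq_or_lt with rfl | h
    · exact le_rfl
    rw [Nord_le_iff (pos₀ τ₂ h₂) (pos₁ τ₂ h₂), ← sub_nonneg]
    exact (key τ₁ h₁ τ₂ h₂).nonneg fun j =>
      mul_nonneg (by positivity) (exp_sub_exp_mul_nonneg (sub_pos.2 h))
  · rintro γ τ₁ h₁ τ₂ h₂ h rfl hN
    have hzero := key τ₁ h₁ τ₂ h₂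
    rw [eq_exp τ₂ h₂, hN, sub_self, hasSum_zero_iff_of_nonneg fun j =>
      mul_nonneg (by positivity) (exp_sub_exp_mul_nonneg (sub_pos.2 h))] at hzero
    have hvan : ∀ j, lam j ≠ Nord a lam τ₁ → a j = 0 := by
      intro j hj
      by_contra haj
      exact (mul_pos (by positivity) (exp_sub_exp_mul_pos (sub_pos.2 h) hj)).ne'
        (congrFun hzero j)
    have hF : ∀ τ, Fsum a lam τ = (∑' j, (a j) ^ 2) * Real.exp (-2 * Nord a lam τ₁ * τ) := by
      intro τ
      rw [Fsum, ← tsum_mul_right]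
      refine tsum_congr fun j => ?_
      by_cases hj : lam j = Nord a lam τ₁
      · rw [hj]
      · simp [hvan j hj]
    exact ⟨hvan, _, pos_of_mul_pos_left (hF τ₁ ▸ pos₀ τ₁ h₁) (Real.exp_pos _).le, hF⟩
end

section
/- Let k ≥ 1 and l ≥ 1 be integers, let h be a Hermitian polynomial on ℝ^k of degree l, let L ∈ ℝ, let e₁ be the first standard basis vector of ℝ^k, let μ be the Gaussian measure e^{−|y|²/4} dy on ℝ^k, and let c be the coefficient of the monomial y₁^l in h. Then ∫_{ℝ^k} ( h(y + L e₁) − h(y) ) dμ(y) = L^l · c · μ(ℝ^k). (This is the translation-average identity for Hermitian polynomials established in the proof of the paper's Lemma 2.2; consequently the absolute value of the left-hand side equals |L|^l |c| μ(ℝ^k), which is the form used there.) -/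
open MeasureTheory Real

namespace MvPolynomial

variable {σ : Type*}

lemma pderiv_pderiv_comm {R : Type*} [CommSemiring R] (i j : σ) (p : MvPolynomial σ R) :
    pderiv i (pderiv j p) = pderiv j (pderiv i p) := by
  classical
  ext m
  rcases eq_or_ne i j with rfl | hij
  · rfl
  · simp only [coeff_pderiv, Finsupp.add_apply, Finsupp.single_eq_of_ne hij,
      Finsupp.single_eq_of_ne hij.symm, add_zero, add_right_comm m (Finsupp.single i 1)]
    ring

lemma coeff_iterate_pderiv {R : Type*} [CommSemiring R] (i : σ) (p : MvPolynomial σ R) (n : ℕ)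
    (m : σ →₀ ℕ) :
    coeff m ((pderiv i)^[n] p) =
      ((m i + 1).ascFactorial n : R) * coeff (m + Finsupp.single i n) p := by
  induction n generalizing m with
  | zero => simp
  | succ n ih =>
    rw [Function.iterate_succ_apply', coeff_pderiv, ih, add_assoc, ← Finsupp.single_add, add_comm 1 n,
      Nat.ascFactorial_succ, ← Nat.succ_ascFactorial]
    simp only [Finsupp.add_apply, Finsupp.single_eq_same]
    push_cast
    ring

/-- The one-variable polynomial `t ↦ p (y + t eᵢ)`. -/
noncomputable def restrictLine {R : Type*} [CommSemiring R] [DecidableEq σ] (y : σ → R) (i : σ) :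
    MvPolynomial σ R →ₐ[R] Polynomial R :=
  aeval fun j => Polynomial.C (y j) + Polynomial.C (Pi.single (M := fun _ => R) i 1 j) * Polynomial.X

section restrictLine

variable {R : Type*} [CommSemiring R] [DecidableEq σ] (y : σ → R) (i : σ)
  (p : MvPolynomial σ R)

lemma eval_restrictLine (t : R) :
    (restrictLine y i p).eval t = eval (fun j => y j + t * Pi.single (M := fun _ => R) i 1 j) p := by
  induction p using MvPolynomial.induction_on with
  | C a => simp [restrictLine]
  | add p q hp hq => simp [hp, hq]
  | mul_X p j hp =>
    rw [map_mul, Polynomial.eval_mul, hp]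
    simp [restrictLine, mul_comm t]

lemma derivative_restrictLine :
    (restrictLine y i p).derivative = restrictLine y i (pderiv i p) := by
  induction p using MvPolynomial.induction_on with
  | C a => simp [restrictLine]
  | add p q hp hq => simp [hp, hq]
  | mul_X p j hp =>
    have hX : (restrictLine y i (X j)).derivative = restrictLine y i (pderiv i (X j)) := by
      rcases eq_or_ne j i with rfl | hj
      · simp [restrictLine]
      · simp [restrictLine, hj, pderiv_X_of_ne hj]
    rw [map_mul, Polynomial.derivative_mul, hp, hX, pderiv_mul, map_add, map_mul, map_mul]

lemma iterate_derivative_restrictLine (n : ℕ) :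
    Polynomial.derivative^[n] (restrictLine y i p) = restrictLine y i ((pderiv i)^[n] p) := by
  induction n with
  | zero => rfl
  | succ n ih =>
    rw [Function.iterate_succ_apply', Function.iterate_succ_apply', ih, derivative_restrictLine]

lemma factorial_mul_coeff_restrictLine (n : ℕ) :
    (n.factorial : R) * (restrictLine y i p).coeff n = eval y ((pderiv i)^[n] p) := by
  have h := eval_restrictLine y i ((pderiv i)^[n] p) 0
  rw [← iterate_derivative_restrictLine, ← Polynomial.coeff_zero_eq_eval_zero,
    Polynomial.coeff_iterate_derivative] at h
  simpa [Nat.descFactorial_self] using h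

lemma natDegree_restrictLine_le :
    (restrictLine y i p).natDegree ≤ p.totalDegree := by
  have := aeval_natDegree_le (n := 1) p le_rfl
    (fun j => Polynomial.C (y j) + Polynomial.C (Pi.single (M := fun _ => R) i 1 j) * Polynomial.X)
    (fun j => by compute_degree)
  simpa [restrictLine] using this

end restrictLine

lemma eval_add_mul_single [DecidableEq σ] (p : MvPolynomial σ ℝ) (y : σ → ℝ) (i : σ) (t : ℝ) :
    eval (fun j => y j + t * Pi.single (M := fun _ => ℝ) i 1 j) p =
      ∑ n ∈ Finset.range (p.totalDegree + 1),
        t ^ n / n.factorial * eval y ((pderiv i)^[n] p) := by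
  rw [← eval_restrictLine, Polynomial.eval_eq_sum_range'
    (Nat.lt_succ_of_le (natDegree_restrictLine_le y i p))]
  refine Finset.sum_congr rfl fun n _ => ?_
  rw [← factorial_mul_coeff_restrictLine]
  have : (n.factorial : ℝ) ≠ 0 := by positivity
  field_simp

lemma iterate_pderiv_totalDegree (p : MvPolynomial σ ℝ) (i : σ) :
    (pderiv i)^[p.totalDegree] p =
      C (p.totalDegree.factorial * coeff (Finsupp.single i p.totalDegree) p) := by
  classical
  ext m
  rw [coeff_iterate_pderiv, coeff_C]
  split_ifs with hm
  · subst hm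
    simp [Nat.one_ascFactorial]
  · rw [coeff_eq_zero_of_totalDegree_lt, mul_zero]
    rw [← Finsupp.degree_apply, map_add, Finsupp.degree_single]
    have : m.degree ≠ 0 := fun h => hm ((Finsupp.degree_eq_zero_iff m).1 h).symm
    omega

/-- The Ornstein–Uhlenbeck operator `Δ - (1/2) ⟨y, ∇⟩` on polynomials. -/
noncomputable def ornsteinUhlenbeck [Fintype σ] (p : MvPolynomial σ ℝ) : MvPolynomial σ ℝ :=
  ∑ i, pderiv i (pderiv i p) - C (1 / 2 : ℝ) * ∑ i, X i * pderiv i p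

lemma pderiv_ornsteinUhlenbeck [Fintype σ] (p : MvPolynomial σ ℝ) (i : σ) :
    pderiv i (ornsteinUhlenbeck p) =
      ornsteinUhlenbeck (pderiv i p) - C (1 / 2 : ℝ) * pderiv i p := by
  classical
  simp only [ornsteinUhlenbeck, map_sub, map_sum, pderiv_mul, pderiv_C, zero_mul, zero_add, pderiv_X,
    Finset.sum_add_distrib]
  simp only [pderiv_pderiv_comm i]
  simp only [Pi.single_apply, ite_mul, zero_mul, one_mul, Finset.sum_ite_eq',
    Finset.mem_univ, if_true]
  ring

lemma ornsteinUhlenbeck_iterate_pderiv [Fintype σ] {p : MvPolynomial σ ℝ} {a : ℝ}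
    (hp : ornsteinUhlenbeck p = C a * p) (i : σ) (n : ℕ) :
    ornsteinUhlenbeck ((pderiv i)^[n] p) = C (a + n / 2) * (pderiv i)^[n] p := by
  induction n with
  | zero => simpa using hp
  | succ n ih =>
    have h := congrArg (pderiv i) ih
    rw [pderiv_ornsteinUhlenbeck, pderiv_C_mul, sub_eq_iff_eq_add, ← add_mul, ← C_add] at h
    rw [Function.iterate_succ_apply', h]
    congr 2
    push_cast
    ring

variable [Fintype σ]

lemma integrable_eval_mul_gaussian (p : MvPolynomial σ ℝ) :
    Integrable fun y : EuclideanSpace ℝ σ => eval (fun i => y i) p * exp (-‖y‖ ^ 2 / 4) := by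
  induction p using MvPolynomial.induction_on' with
  | add p q hp hq =>
    simp only [map_add, add_mul]
    exact hp.add hq
  | monomial m a =>
    have h1 (n : ℕ) : Integrable fun x : ℝ => x ^ n * exp (-x ^ 2 / 4) := by
      have := integrable_rpow_mul_exp_neg_mul_sq (b := 1 / 4) (by norm_num) (s := n)
        (by linarith [n.cast_nonneg (α := ℝ)])
      simpa [neg_mul, neg_div, div_eq_inv_mul] using this
    have h2 := (Integrable.fintype_prod (f := fun i (x : ℝ) => x ^ m i * exp (-x ^ 2 / 4))
      fun i => h1 (m i)).const_mul a
    have h3 := (PiLp.volume_preserving_ofLp σ).integrable_comp_of_integrable h2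
    refine h3.congr (.of_forall fun y => ?_)
    simp only [Function.comp_apply, eval_monomial, Finset.prod_mul_distrib, ← exp_sum,
      EuclideanSpace.norm_sq_eq, norm_eq_abs, sq_abs, ← Finset.sum_div, Finset.sum_neg_distrib]
    rw [Finsupp.prod_fintype _ _ (by simp)]
    simp [mul_assoc]

lemma integral_pderiv_mul_gaussian (p : MvPolynomial σ ℝ) (i : σ) :
    ∫ y : EuclideanSpace ℝ σ, eval (fun j => y j) (pderiv i p) * exp (-‖y‖ ^ 2 / 4) =
      1 / 2 * ∫ y : EuclideanSpace ℝ σ, eval (fun j => y j) (X i * p) * exp (-‖y‖ ^ 2 / 4) := by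
  classical
  have hp (y : EuclideanSpace ℝ σ) : HasLineDerivAt ℝ
      (fun y : EuclideanSpace ℝ σ => eval (fun j => y j) p)
      (eval (fun j => y j) (pderiv i p)) y (EuclideanSpace.single i 1) := by
    have h := (restrictLine (fun j => y j) i p).hasDerivAt 0
    rw [derivative_restrictLine, eval_restrictLine] at h
    simp only [eval_restrictLine, zero_mul, add_zero] at h
    simpa [HasLineDerivAt, Pi.single_apply] using h
  have hg (y : EuclideanSpace ℝ σ) : HasLineDerivAt ℝ
      (fun y : EuclideanSpace ℝ σ => exp (-‖y‖ ^ 2 / 4))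
      (-(1 / 2) * (y i * exp (-‖y‖ ^ 2 / 4))) y (EuclideanSpace.single i 1) := by
    have h := (((hasStrictFDerivAt_norm_sq y).hasFDerivAt.const_mul
      (-(1 / 4) : ℝ)).exp).hasLineDerivAt (EuclideanSpace.single i 1)
    have he (x : EuclideanSpace ℝ σ) : -(1 / 4) * ‖x‖ ^ 2 = -‖x‖ ^ 2 / 4 := by ring
    simp only [he] at h
    have hv : (exp (-‖y‖ ^ 2 / 4) • (-(1 / 4) : ℝ) • 2 • innerSL ℝ y) (EuclideanSpace.single i 1) =
        -(1 / 2) * (y i * exp (-‖y‖ ^ 2 / 4)) := by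
      simp [EuclideanSpace.inner_single_right]
      ring
    exact hv ▸ h
  have hX : Integrable fun y : EuclideanSpace ℝ σ =>
      eval (fun j => y j) p * (-(1 / 2) * (y i * exp (-‖y‖ ^ 2 / 4))) := by
    refine ((integrable_eval_mul_gaussian (X i * p)).const_mul (-(1 / 2))).congr
      (.of_forall fun y => ?_)
    simp
    ring
  have h := integral_bilinear_hasLineDerivAt_right_eq_neg_left_of_integrable
    (B := ContinuousLinearMap.mul ℝ ℝ) (integrable_eval_mul_gaussian (pderiv i p)) hX
    (integrable_eval_mul_gaussian p) (fun y _ => hp y) (fun y _ => hg y)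
  simp only [ContinuousLinearMap.mul_apply'] at h
  rw [← neg_eq_iff_eq_neg.2 h, ← integral_neg, ← integral_const_mul]
  congr with y
  simp
  ring

lemma integral_ornsteinUhlenbeck_mul_gaussian (p : MvPolynomial σ ℝ) :
    ∫ y : EuclideanSpace ℝ σ,
      eval (fun j => y j) (ornsteinUhlenbeck p) * exp (-‖y‖ ^ 2 / 4) = 0 := by
  have h : ornsteinUhlenbeck p =
      ∑ i, (pderiv i (pderiv i p) - C (1 / 2 : ℝ) * (X i * pderiv i p)) := by
    rw [ornsteinUhlenbeck, Finset.sum_sub_distrib, Finset.mul_sum]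
  simp only [h, map_sum, Finset.sum_mul]
  rw [integral_finsetSum _ fun i _ => integrable_eval_mul_gaussian _]
  refine Finset.sum_eq_zero fun i _ => ?_
  have hC := (integrable_eval_mul_gaussian (X i * pderiv i p)).const_mul (1 / 2)
  have := integral_sub (integrable_eval_mul_gaussian (pderiv i (pderiv i p))) hC
  rw [integral_pderiv_mul_gaussian, integral_const_mul, sub_self] at this
  rw [← this]
  congr with y
  simp only [map_sub, map_mul, eval_C]
  ring

lemma integral_mul_gaussian_eq_zero {p : MvPolynomial σ ℝ} {a : ℝ} (ha : a ≠ 0)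
    (hp : ornsteinUhlenbeck p = C a * p) :
    ∫ y : EuclideanSpace ℝ σ, eval (fun j => y j) p * exp (-‖y‖ ^ 2 / 4) = 0 := by
  have h := integral_ornsteinUhlenbeck_mul_gaussian p
  simp only [hp, map_mul, eval_C, mul_assoc, integral_const_mul] at h
  exact (mul_eq_zero.1 h).resolve_left ha

end MvPolynomial

/-- the translation-average identity in the proof of Lemma 2.2 of the
paper. For a Hermitian polynomial `h` of degree `l ≥ 1` on `ℝ^k`, every `L ∈ ℝ`, with `e₁`
the first standard basis vector and `μ = e^{-|y|²/4} dy`,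
`∫ (h(y + L e₁) − h(y)) dμ(y) = L^l · c · μ(ℝ^k)`,
where `c` is the coefficient of the monomial `y₁^l` in `h`. -/
theorem stmt14 (k l : ℕ) (hk : 0 < k) (hl : 1 ≤ l)
    (h : MvPolynomial (Fin k) ℝ) (hherm : IsHermitianPoly k l h) (L : ℝ) :
    (∫ y : EuclideanSpace ℝ (Fin k),
        (MvPolynomial.eval
            (fun i => (y + L • EuclideanSpace.single (⟨0, hk⟩ : Fin k) (1 : ℝ)) i) h
          - MvPolynomial.eval (fun i => y i) h) * Real.exp (-‖y‖ ^ 2 / 4))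
      = L ^ l * MvPolynomial.coeff (Finsupp.single (⟨0, hk⟩ : Fin k) l) h *
          ∫ y : EuclideanSpace ℝ (Fin k), Real.exp (-‖y‖ ^ 2 / 4) := by
  obtain ⟨rfl, hh⟩ := hherm
  set i₀ : Fin k := ⟨0, hk⟩
  have heig : h.ornsteinUhlenbeck = MvPolynomial.C (-(h.totalDegree : ℝ) / 2) * h := by
    rw [neg_div, map_neg, neg_mul]
    exact eq_neg_of_add_eq_zero_left hh
  have hint (n : ℕ) := (MvPolynomial.integrable_eval_mul_gaussian
    ((MvPolynomial.pderiv i₀)^[n] h)).const_mul (L ^ n / n.factorial)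
  have hzero (n : ℕ) (hn : n < h.totalDegree) := MvPolynomial.integral_mul_gaussian_eq_zero
    (a := -(h.totalDegree : ℝ) / 2 + n / 2)
    (by have : (n : ℝ) < h.totalDegree := by exact_mod_cast hn
        linarith)
    (MvPolynomial.ornsteinUhlenbeck_iterate_pderiv heig i₀ n)
  have htaylor (y : EuclideanSpace ℝ (Fin k)) :
      (MvPolynomial.eval (fun i => (y + L • EuclideanSpace.single i₀ (1 : ℝ)) i) h
          - MvPolynomial.eval (fun i => y i) h) * Real.exp (-‖y‖ ^ 2 / 4) =
        (∑ n ∈ Finset.range (h.totalDegree + 1), L ^ n / n.factorial *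
          (MvPolynomial.eval (fun i => y i) ((MvPolynomial.pderiv i₀)^[n] h) *
            Real.exp (-‖y‖ ^ 2 / 4))) -
          MvPolynomial.eval (fun i => y i) h * Real.exp (-‖y‖ ^ 2 / 4) := by
    simp only [← mul_assoc]
    rw [← Finset.sum_mul, ← MvPolynomial.eval_add_mul_single, ← sub_mul]
    simp [Pi.single_apply]
  simp only [htaylor]
  rw [integral_sub (integrable_finsetSum _ fun n _ => hint n)
    (MvPolynomial.integrable_eval_mul_gaussian h), integral_finsetSum _ fun n _ => hint n,
    Finset.sum_range_succ, Finset.sum_eq_zero fun n hn => by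
      rw [integral_const_mul, hzero n (Finset.mem_range.1 hn), mul_zero]]
  have h0 := hzero 0 (by omega)
  rw [Function.iterate_zero_apply] at h0
  simp only [MvPolynomial.iterate_pderiv_totalDegree, MvPolynomial.eval_C, integral_const_mul, h0]
  have : (h.totalDegree.factorial : ℝ) ≠ 0 := by positivity
  field_simp
  ring
end
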